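/- There exists an absolute constant C > 0 such that for every odd prime p and every a with a ≢ 0 (mod p), one has |F_7(a,0,p−1) − p^6| ≤ C · p^{6 − 1/8} · (log p)^{5/4}; equivalently, F_7(a,0,p−1) = p^6 · (1 + O(p^{−1/8}(log p)^{5/4})) uniformly in a. -/

import Mathlib

open Polynomial in
theorem Polynomial.sum_C_mul_X_pow_mul_ne_zero {ι R : Type*} [Fintype ι] [CommRing R] [IsDomain R]
    {e : ι → ℕ} (he : Function.Injective e) {u : ι → R[X]} (hu : ∀ i, (u i).coeff 0 ≠ 0)
    {v : ι → R} (hv : v ≠ 0) : ∑ i, C (v i) * (X ^ e i * u i) ≠ 0 := by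
  classical
  obtain ⟨i₁, hi₁⟩ := Function.ne_iff.mp hv
  obtain ⟨i₀, hi₀, hmin⟩ := Finset.exists_min_image (Finset.univ.filter fun i => v i ≠ 0) e
    ⟨i₁, by simpa using hi₁⟩
  simp only [Finset.mem_filter, Finset.mem_univ, true_and] at hi₀ hmin
  intro h
  have := congrArg (fun q => q.coeff (e i₀)) h
  simp only [finsetSum_coeff, coeff_C_mul, coeff_zero, coeff_X_pow_mul'] at this
  rw [Finset.sum_eq_single i₀] at this
  · simp [hi₀, hu] at this
  · intro i _ hi
    by_cases hvi : v i = 0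
    · simp [hvi]
    · have h1 := hmin i hvi
      have h2 : e i ≠ e i₀ := fun h => hi (he h)
      rw [if_neg (by omega), mul_zero]
  · simp

open Polynomial in
/-- The auxiliary polynomial of the Stepanov method, with the Frobenius power `x ^ (P ^ 2)` in place
of derivatives. -/
theorem exists_stepanov_polynomial {L : Type*} [Field L] (p : ℕ) [Fact p.Prime] [CharP L p]
    (μ P D G' m K : ℕ) (hP : P = p ^ μ) (hD : D * G' = P - 1) (h : L[X]) (hh : h.coeff 0 ≠ 0)
    (hm : (X * h).natDegree = m) (hm0 : 0 < m)
    (hdim : P * (G' * (P + 1) + P * m + K) < D * K * (G' * (P + 1))) (c : L) (hc : c ≠ 0)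
    (S : Finset L) (hS : ∀ x ∈ S, x ^ P ^ 2 = x ∧ ((X * h).eval x) ^ (G' * (P + 1)) = c) :
    ∃ R : L[X], R ≠ 0 ∧ R.natDegree ≤ P ^ 2 * m + P ^ 2 * K ∧ ∀ x ∈ S, (X - C x) ^ P ∣ R := by
  classical
  have hp : p.Prime := Fact.out
  have hP0 : 0 < P := hP ▸ pow_pos hp.pos μ
  set f : L[X] := X * h with hf
  set G := G' * (P + 1) with hG
  set T := G + P * m + K with hT
  have hDG : D * G = P ^ 2 - 1 := by
    rw [hG, ← mul_assoc, hD, mul_comm, ← Nat.sq_sub_sq, one_pow]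
  have hG0 : 0 < G := Nat.pos_of_ne_zero fun h0 => by simp [h0] at hdim
  have hG'0 : 0 < G' := Nat.pos_of_ne_zero fun h0 => by simp [hG, h0] at hG0
  let B : Fin D × Fin K × Fin G → ℕ → L[X] := fun i l =>
    C (c ^ (i.1 : ℕ)) * f ^ ((D - 1 - i.1) * G') * X ^ (i.2.1 : ℕ) *
      hasseDeriv l (X ^ (i.2.2 : ℕ) * f ^ (i.1 * G'))
  have hBdeg : ∀ i l, (B i l).natDegree < T := by
    rintro ⟨j, k, i⟩ l
    have h1 : (hasseDeriv l (X ^ (i : ℕ) * f ^ (j * G'))).natDegree ≤ i + j * G' * m := by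
      refine (natDegree_hasseDeriv_le _ _).trans ((Nat.sub_le _ _).trans ?_)
      refine natDegree_mul_le.trans ?_
      rw [natDegree_X_pow, natDegree_pow, hm]
    have h2 : (B (j, k, i) l).natDegree ≤ (D - 1 - j) * G' * m + k + (i + j * G' * m) := by
      refine natDegree_mul_le.trans (add_le_add ?_ h1)
      refine natDegree_mul_le.trans (add_le_add ?_ (natDegree_X_pow _).le)
      refine natDegree_mul_le.trans ?_
      rw [natDegree_C, natDegree_pow, hm, zero_add]
    refine h2.trans_lt ?_
    have h3 : (D - 1 - j) * G' * m + j * G' * m ≤ P * m := by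
      rw [← add_mul, ← add_mul]
      refine Nat.mul_le_mul_right _ ?_
      calc (D - 1 - j + j) * G' ≤ D * G' := Nat.mul_le_mul_right _ (by omega)
        _ ≤ P := by omega
    have := i.2
    have := k.2
    omega
  let Φ : (Fin D × Fin K × Fin G → L) →ₗ[L] (Fin P × Fin T → L) :=
    LinearMap.pi fun lt => (lcoeff L lt.2).comp
      (Fintype.linearCombination L (fun i => B i lt.1))
  obtain ⟨v, hvmem, hv⟩ : ∃ v ∈ LinearMap.ker Φ, v ≠ 0 := by
    refine Submodule.exists_mem_ne_zero_of_ne_bot (LinearMap.ker_ne_bot_of_finrank_lt ?_)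
    simp only [Module.finrank_fintype_fun_eq_card, Fintype.card_prod, Fintype.card_fin]
    rwa [← mul_assoc]
  have hA : ∀ l < P, ∑ i, v i • B i l = 0 := by
    intro l hl
    ext t
    by_cases ht : t < T
    · have := congrFun (LinearMap.mem_ker.mp hvmem) (⟨l, hl⟩, ⟨t, ht⟩)
      simpa [Φ, Fintype.linearCombination_apply] using this
    · rw [coeff_zero, finsetSum_coeff]
      refine Finset.sum_eq_zero fun i _ => ?_
      rw [coeff_smul, coeff_eq_zero_of_natDegree_lt ((hBdeg i l).trans_le (not_lt.mp ht)),
        smul_zero]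
  let e : Fin D × Fin K × Fin G → ℕ := fun i => i.2.2 + i.1 * G + P ^ 2 * i.2.1
  refine ⟨∑ i, C (v i) * (X ^ e i * h ^ (i.1 * G)), ?_, ?_, ?_⟩
  · refine sum_C_mul_X_pow_mul_ne_zero ?_ (fun i => ?_) hv
    · rintro ⟨j, k, i⟩ ⟨j', k', i'⟩ heq
      have key : ∀ (j : Fin D) (i : Fin G), (i : ℕ) + j * G < P ^ 2 := by
        intro j i
        have : (j + 1 : ℕ) * G ≤ D * G := Nat.mul_le_mul_right _ j.2
        have := i.2
        have : 0 < P ^ 2 := by positivity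
        rw [add_mul] at *
        omega
      simp only [e] at heq
      have h1 := congrArg (· % P ^ 2) heq
      have h2 := congrArg (· / P ^ 2) heq
      simp only [Nat.add_mul_mod_self_left, Nat.mod_eq_of_lt (key _ _),
        Nat.add_mul_div_left _ _ (show 0 < P ^ 2 by positivity),
        Nat.div_eq_of_lt (key _ _)] at h1 h2
      have h3 := congrArg (· % G) h1
      have h4 := congrArg (· / G) h1
      simp only [Nat.add_mul_mod_self_right, Nat.mod_eq_of_lt i.2, Nat.mod_eq_of_lt i'.2,
        Nat.add_mul_div_right _ _ hG0, Nat.div_eq_of_lt i.2, Nat.div_eq_of_lt i'.2] at h3 h4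
      simp only [Prod.mk.injEq, Fin.ext_iff]
      omega
    · rw [coeff_zero_eq_eval_zero, eval_pow, ← coeff_zero_eq_eval_zero]
      exact pow_ne_zero _ hh
  · refine natDegree_sum_le_of_forall_le _ _ fun ⟨j, k, i⟩ _ => ?_
    refine (natDegree_C_mul_le _ _).trans ?_
    have : (X : L[X]) ^ e (j, k, i) * h ^ (j * G) = X ^ (i + P ^ 2 * k : ℕ) * f ^ (j * G) := by
      simp only [e, hf]; ring
    rw [this]
    refine natDegree_mul_le.trans ?_
    rw [natDegree_X_pow, natDegree_pow, hm]
    have h1 : (j + 1 : ℕ) * G ≤ P ^ 2 := (Nat.mul_le_mul_right _ j.2).trans (by omega)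
    have h2 : (j * G + G) * m ≤ P ^ 2 * m := Nat.mul_le_mul_right _ (by linarith)
    have h3 : P ^ 2 * (k + 1) ≤ P ^ 2 * K := Nat.mul_le_mul_left _ k.2
    have h4 : G ≤ G * m := Nat.le_mul_of_pos_right _ hm0
    have := i.2
    rw [add_mul] at h2
    rw [mul_add] at h3
    omega
  · intro x hx
    obtain ⟨hxQ, hxc⟩ := hS x hx
    have hfx : f.eval x ≠ 0 := fun h0 => by
      rw [h0, zero_pow hG0.ne'] at hxc; exact hc hxc.symm
    -- `P`-th powers are constant modulo `(X - x) ^ P`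
    have hfrob : ∀ q : L[X], (X - C x) ^ P ∣ q ^ P - C (q.eval x ^ P) := by
      intro q
      have : q ^ P - C (q.eval x ^ P) = (q - C (q.eval x)) ^ P := by
        rw [hP, sub_pow_char_pow, C_pow]
      rw [this]
      exact pow_dvd_pow_of_dvd (dvd_iff_isRoot.mpr (by simp)) _
    set I := Ideal.span {(X - C x) ^ P} with hI
    rw [← Ideal.mem_span_singleton, ← hI, ← Ideal.Quotient.eq_zero_iff_mem]
    have hq : ∀ q : L[X], Ideal.Quotient.mk I (q ^ P) = Ideal.Quotient.mk I (C (q.eval x ^ P)) :=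
      fun q => Ideal.Quotient.eq.mpr (Ideal.mem_span_singleton.mpr (hfrob q))
    have hterm : ∀ i : Fin D × Fin K × Fin G,
        Ideal.Quotient.mk I (C (v i) * (X ^ e i * h ^ (i.1 * G))) =
        Ideal.Quotient.mk I (C (v i * (f.eval x) ^ (i.1 * G' * P) * x ^ (i.2.1 : ℕ)) *
          (X ^ (i.2.2 : ℕ) * f ^ (i.1 * G'))) := by
      rintro ⟨j, k, i⟩
      have h1 : (X : L[X]) ^ e (j, k, i) * h ^ (j * G) =
          X ^ (i : ℕ) * f ^ (j * G') * (f ^ (j * G')) ^ P * (X ^ (P * k)) ^ P := by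
        simp only [e, hf, hG]; ring
      have h2 : x ^ (P * k * P) = x ^ (k : ℕ) := by
        rw [show P * k * P = P ^ 2 * k by ring, pow_mul, hxQ]
      simp only [h1]
      rw [map_mul, map_mul, map_mul _ _ ((f ^ (j * G')) ^ P), hq, hq]
      simp only [eval_pow, eval_X, ← pow_mul, h2]
      simp only [map_mul, map_pow]
      ring
    rw [map_sum, Finset.sum_congr rfl fun i _ => hterm i, ← map_sum,
      Ideal.Quotient.eq_zero_iff_mem, hI, Ideal.mem_span_singleton]
    rw [← map_dvd_iff (taylorEquiv x)]
    simp only [map_pow, map_sub]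
    have : (taylorEquiv x) X - (taylorEquiv x) (C x) = (X : L[X]) := by
      change taylor x X - taylor x (C x) = X
      simp
    rw [this, X_pow_dvd_iff]
    intro l hl
    have h1 := congrArg (eval x) (hA l hl)
    rw [eval_finsetSum, eval_zero] at h1
    have h2 : (f.eval x) ^ ((D - 1) * G') ≠ 0 := pow_ne_zero _ hfx
    have : (taylorEquiv x) (∑ i : Fin D × Fin K × Fin G,
        C (v i * (f.eval x) ^ (i.1 * G' * P) * x ^ (i.2.1 : ℕ)) *
          (X ^ (i.2.2 : ℕ) * f ^ (i.1 * G'))) =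
        taylor x (∑ i : Fin D × Fin K × Fin G,
        C (v i * (f.eval x) ^ (i.1 * G' * P) * x ^ (i.2.1 : ℕ)) *
          (X ^ (i.2.2 : ℕ) * f ^ (i.1 * G'))) := rfl
    rw [this, taylor_coeff, map_sum, eval_finsetSum]
    rw [← mul_right_inj' h2, mul_zero, ← h1, Finset.mul_sum]
    refine Finset.sum_congr rfl fun ⟨j, k, i⟩ _ => ?_
    rw [← smul_eq_C_mul, map_smul, eval_smul]
    simp only [B, eval_smul, eval_mul, eval_C, eval_pow, eval_X, smul_eq_mul]
    have h3 : c ^ (j : ℕ) = (f.eval x) ^ (j * G' * P) * (f.eval x) ^ (j * G') := by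
      rw [← hxc]; simp only [hG]; ring
    have h4 : (f.eval x) ^ ((D - 1) * G') =
        (f.eval x) ^ ((D - 1 - j) * G') * (f.eval x) ^ (j * G') := by
      rw [← pow_add, ← add_mul, Nat.sub_add_cancel (by have := j.2; omega)]
    rw [h3, h4]
    ring

open Polynomial in
theorem card_eval_pow_eq_le {L : Type*} [Field L] (p : ℕ) [Fact p.Prime] [CharP L p]
    (μ P D G' m : ℕ) (hP : P = p ^ μ) (hP3 : 3 ≤ P) (hD : D * G' = P - 1)
    (h : L[X]) (hh : h.coeff 0 ≠ 0)
    (hm : (X * h).natDegree = m) (c : L) (hc : c ≠ 0)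
    (S : Finset L) (hS : ∀ x ∈ S, x ^ P ^ 2 = x ∧ ((X * h).eval x) ^ (G' * (P + 1)) = c) :
    S.card ≤ P * (G' + 3 * m + 4) := by
  classical
  have hm0 : 0 < m := by
    have h0 : h ≠ 0 := by rintro rfl; simp at hh
    rw [← hm, natDegree_mul X_ne_zero h0, natDegree_X]; omega
  have hdim : P * (G' * (P + 1) + P * m + (G' + 2 * m + 4)) <
      D * (G' + 2 * m + 4) * (G' * (P + 1)) := by
    have hG'P : G' ≤ P - 1 := by
      rw [← hD]
      refine Nat.le_mul_of_pos_left _ (Nat.pos_of_ne_zero ?_)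
      rintro rfl
      omega
    have h1 : D * (G' + 2 * m + 4) * (G' * (P + 1)) = (G' + 2 * m + 4) * ((P - 1) * (P + 1)) := by
      rw [← hD]; ring
    rw [h1]
    obtain ⟨P, rfl⟩ : ∃ P', P = P' + 3 := ⟨P - 3, by omega⟩
    simp only [show P + 3 - 1 = P + 2 by omega] at *
    nlinarith [Nat.zero_le (m * P), Nat.zero_le (m * P * P), Nat.zero_le (P * P),
      Nat.mul_le_mul_right P hG'P]
  obtain ⟨R, hR0, hRdeg, hR⟩ := exists_stepanov_polynomial p μ P D G' m (G' + 2 * m + 4) hP hD h hh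
    hm hm0 hdim c hc S hS
  have hdvd : ∏ x ∈ S, (X - C x) ^ P ∣ R := by
    refine Finset.prod_dvd_of_coprime (fun x _ y _ hxy => ?_) hR
    exact (isCoprime_X_sub_C_of_isUnit_sub (sub_ne_zero.mpr hxy).isUnit).pow
  have hle := natDegree_le_of_dvd hdvd hR0
  rw [natDegree_prod_of_monic _ _ fun x _ => (monic_X_sub_C x).pow P] at hle
  simp only [natDegree_pow, natDegree_X_sub_C, mul_one, Finset.sum_const, smul_eq_mul] at hle
  have h2 : S.card * P ≤ P * (G' + 3 * m + 4) * P := by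
    refine hle.trans (hRdeg.trans (le_of_eq ?_)); ring
  exact Nat.le_of_mul_le_mul_right h2 (by omega)


section MonicSums

open Polynomial

variable {F : Type*} [Field F] [Fintype F]

variable (F) in
/-- The monic polynomials of degree `n` over a finite field. -/
noncomputable def monicsOfDegree (n : ℕ) : Finset F[X] :=
  Set.Finite.toFinset (s := {g : F[X] | g.Monic ∧ g.natDegree = n}) <| by
    have : Finite (degreeLT F n) := Finite.of_equiv _ (degreeLTEquiv F n).toEquiv.symm
    exact Finite.of_equiv _ (monicEquivDegreeLT n).symm

@[simp]
theorem mem_monicsOfDegree {n : ℕ} {g : F[X]} :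
    g ∈ monicsOfDegree F n ↔ g.Monic ∧ g.natDegree = n :=
  Set.Finite.mem_toFinset _

open Classical in
variable (F) in
/-- The monic irreducible polynomials of degree `n` over a finite field. -/
noncomputable def monicIrreduciblesOfDegree (n : ℕ) : Finset F[X] :=
  (monicsOfDegree F n).filter Irreducible

@[simp]
theorem mem_monicIrreduciblesOfDegree {n : ℕ} {g : F[X]} :
    g ∈ monicIrreduciblesOfDegree F n ↔ (g.Monic ∧ g.natDegree = n) ∧ Irreducible g := by
  simp [monicIrreduciblesOfDegree]

/-- The sum of `ψ` over all monic polynomials of degree `n`. -/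
noncomputable def monicSum (ψ : F[X] →* ℂ) (n : ℕ) : ℂ :=
  ∑ g ∈ monicsOfDegree F n, ψ g

/-- The sum of `ψ` over all prime powers of degree `n`, with von Mangoldt weights. -/
noncomputable def primePowerSum (ψ : F[X] →* ℂ) (n : ℕ) : ℂ :=
  ∑ d ∈ n.divisors, ∑ P ∈ monicIrreduciblesOfDegree F d, (d : ℂ) * ψ P ^ (n / d)

theorem monicSum_zero (ψ : F[X] →* ℂ) : monicSum ψ 0 = 1 := by
  have : monicsOfDegree F 0 = {1} := by
    ext g
    simp only [mem_monicsOfDegree, Finset.mem_singleton]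
    constructor
    · rintro ⟨h1, h2⟩; exact h1.natDegree_eq_zero.mp h2
    · rintro rfl; simp
  simp [monicSum, this]

open Classical in
theorem sum_monicsOfDegree_filter_dvd (ψ : F[X] →* ℂ) {h : F[X]} (hh : h.Monic) {n k : ℕ}
    (hk : h.natDegree = k) (hkn : k ≤ n) :
    ∑ g ∈ (monicsOfDegree F n).filter (h ∣ ·), ψ g = ψ h * monicSum ψ (n - k) := by
  rw [monicSum, Finset.mul_sum]
  symm
  refine Finset.sum_bij (fun g _ => h * g) ?_ ?_ ?_ ?_
  · intro g hg
    rw [mem_monicsOfDegree] at hg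
    simp only [Finset.mem_filter, mem_monicsOfDegree, dvd_mul_right, and_true]
    refine ⟨hh.mul hg.1, ?_⟩
    rw [hh.natDegree_mul hg.1, hk, hg.2]; omega
  · intro g _ g' _ hgg
    exact mul_left_cancel₀ hh.ne_zero hgg
  · rintro g hg
    simp only [Finset.mem_filter, mem_monicsOfDegree] at hg
    obtain ⟨⟨hgm, hgd⟩, q, rfl⟩ := hg
    have hq : q.Monic := hh.of_mul_monic_left hgm
    refine ⟨q, ?_, rfl⟩
    rw [hh.natDegree_mul hq] at hgd
    rw [mem_monicsOfDegree]
    exact ⟨hq, by omega⟩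
  · intro g _
    rw [map_mul]

open Classical in
/-- The polynomial analogue of `∑_{d ∣ n} Λ(d) = log n`. -/
theorem natDegree_eq_sum_pow_dvd {n : ℕ} {g : F[X]} (hg : g ∈ monicsOfDegree F n) :
    n = ∑ d ∈ Finset.Icc 1 n, ∑ P ∈ monicIrreduciblesOfDegree F d,
      ∑ j ∈ Finset.Icc 1 n, if P ^ j ∣ g then d else 0 := by
  rw [mem_monicsOfDegree] at hg
  obtain ⟨hgm, hgd⟩ := hg
  have hg0 : g ≠ 0 := hgm.ne_zero
  have hmon : ∀ P ∈ UniqueFactorizationMonoid.normalizedFactors g, P.Monic := fun P hP => by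
    rw [← UniqueFactorizationMonoid.normalize_normalized_factor P hP]
    exact monic_normalize (UniqueFactorizationMonoid.prime_of_normalized_factor P hP).ne_zero
  have hprod : (UniqueFactorizationMonoid.normalizedFactors g).prod = g := by
    rw [UniqueFactorizationMonoid.prod_normalizedFactors_eq hg0, hgm.normalize_eq_self]
  have hcount : ∀ d ∈ Finset.Icc 1 n, ∀ P ∈ monicIrreduciblesOfDegree F d,
      (∑ j ∈ Finset.Icc 1 n, if P ^ j ∣ g then d else 0) =
        (UniqueFactorizationMonoid.normalizedFactors g).count P * d := by
    intro d hd P hP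
    rw [mem_monicIrreduciblesOfDegree] at hP
    have hdvd : ∀ j, P ^ j ∣ g ↔ j ≤ (UniqueFactorizationMonoid.normalizedFactors g).count P := by
      intro j
      rw [pow_dvd_iff_le_emultiplicity,
        UniqueFactorizationMonoid.emultiplicity_eq_count_normalizedFactors hP.2 hg0,
        hP.1.1.normalize_eq_self]
      simp
    have hle : (UniqueFactorizationMonoid.normalizedFactors g).count P ≤ n := by
      have h1 := natDegree_le_of_dvd ((hdvd _).mpr le_rfl) hg0
      rw [natDegree_pow, hP.1.2, hgd] at h1
      exact (Nat.le_mul_of_pos_right _ (Finset.mem_Icc.mp hd).1).trans h1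
    simp only [hdvd]
    rw [← Finset.sum_filter, Finset.sum_const, smul_eq_mul]
    congr 1
    have : (Finset.Icc 1 n).filter
        (· ≤ (UniqueFactorizationMonoid.normalizedFactors g).count P) =
        Finset.Icc 1 ((UniqueFactorizationMonoid.normalizedFactors g).count P) := by
      ext j; simp only [Finset.mem_filter, Finset.mem_Icc]; omega
    rw [this, Nat.card_Icc]; omega
  rw [Finset.sum_congr rfl fun d hd => Finset.sum_congr rfl (hcount d hd)]
  calc n = ((UniqueFactorizationMonoid.normalizedFactors g).map natDegree).sum := by
        rw [← natDegree_multiset_prod_of_monic _ hmon, hprod, hgd]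
    _ = ∑ P ∈ (UniqueFactorizationMonoid.normalizedFactors g).toFinset,
        (UniqueFactorizationMonoid.normalizedFactors g).count P * P.natDegree := by
        rw [Finset.sum_multiset_map_count]; simp
    _ = ∑ P ∈ (Finset.Icc 1 n).biUnion (monicIrreduciblesOfDegree F),
        (UniqueFactorizationMonoid.normalizedFactors g).count P * P.natDegree := by
        refine Finset.sum_subset ?_ ?_
        · intro P hP
          rw [Multiset.mem_toFinset] at hP
          have hirr := UniqueFactorizationMonoid.irreducible_of_normalized_factor P hP
          simp only [Finset.mem_biUnion, mem_monicIrreduciblesOfDegree, Finset.mem_Icc]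
          refine ⟨P.natDegree, ⟨hirr.natDegree_pos, ?_⟩, ⟨hmon P hP, rfl⟩, hirr⟩
          rw [← hgd]
          exact natDegree_le_of_dvd (UniqueFactorizationMonoid.dvd_of_mem_normalizedFactors hP) hg0
        · intro P _ hP
          rw [Multiset.mem_toFinset] at hP
          rw [Multiset.count_eq_zero_of_notMem hP, zero_mul]
    _ = _ := by
        rw [Finset.sum_biUnion]
        · refine Finset.sum_congr rfl fun d _ => Finset.sum_congr rfl fun P hP => ?_
          rw [mem_monicIrreduciblesOfDegree] at hP
          rw [hP.1.2]
        · intro d _ d' _ hdd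
          rw [Function.onFun, Finset.disjoint_left]
          intro P hP hP'
          rw [mem_monicIrreduciblesOfDegree] at hP hP'
          exact hdd (hP.1.2.symm.trans hP'.1.2)

/-- The logarithmic derivative of the `L`-series `∑ monicSum ψ n * T ^ n`. -/
theorem natCast_mul_monicSum (ψ : F[X] →* ℂ) (n : ℕ) :
    (n : ℂ) * monicSum ψ n = ∑ k ∈ Finset.Icc 1 n, primePowerSum ψ k * monicSum ψ (n - k) := by
  classical
  have h1 : (n : ℂ) * monicSum ψ n = ∑ d ∈ Finset.Icc 1 n, ∑ P ∈ monicIrreduciblesOfDegree F d,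
      ∑ j ∈ Finset.Icc 1 n, ∑ g ∈ (monicsOfDegree F n).filter (P ^ j ∣ ·), (d : ℂ) * ψ g := by
    rw [monicSum, Finset.mul_sum]
    have : ∀ g ∈ monicsOfDegree F n, (n : ℂ) * ψ g =
        ∑ d ∈ Finset.Icc 1 n, ∑ P ∈ monicIrreduciblesOfDegree F d,
          ∑ j ∈ Finset.Icc 1 n, if P ^ j ∣ g then (d : ℂ) * ψ g else 0 := by
      intro g hg
      conv_lhs => rw [natDegree_eq_sum_pow_dvd hg]
      push_cast
      simp only [Finset.sum_mul, ite_mul, zero_mul]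
    rw [Finset.sum_congr rfl this, Finset.sum_comm]
    refine Finset.sum_congr rfl fun d _ => ?_
    rw [Finset.sum_comm]
    refine Finset.sum_congr rfl fun P _ => ?_
    rw [Finset.sum_comm]
    refine Finset.sum_congr rfl fun j _ => ?_
    rw [Finset.sum_filter]
  have h2 : ∀ d ∈ Finset.Icc 1 n, ∀ P ∈ monicIrreduciblesOfDegree F d, ∀ j ∈ Finset.Icc 1 n,
      ∑ g ∈ (monicsOfDegree F n).filter (P ^ j ∣ ·), (d : ℂ) * ψ g =
        if j * d ≤ n then (d : ℂ) * ψ P ^ j * monicSum ψ (n - j * d) else 0 := by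
    intro d _ P hP j _
    rw [mem_monicIrreduciblesOfDegree] at hP
    have hdeg : (P ^ j).natDegree = j * d := by rw [natDegree_pow, hP.1.2]
    split_ifs with hjd
    · rw [← Finset.mul_sum, sum_monicsOfDegree_filter_dvd ψ (hP.1.1.pow j) hdeg hjd, map_pow,
        mul_assoc]
    · refine Finset.sum_eq_zero fun g hg => ?_
      exfalso
      simp only [Finset.mem_filter, mem_monicsOfDegree] at hg
      have := natDegree_le_of_dvd hg.2 hg.1.1.ne_zero
      omega
  rw [h1, Finset.sum_congr rfl fun d hd => Finset.sum_congr rfl fun P hP =>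
    Finset.sum_congr rfl (h2 d hd P hP)]
  simp only [primePowerSum, Finset.sum_mul]
  have h3 : ∀ k ∈ Finset.Icc 1 n, (∑ d ∈ k.divisors, ∑ P ∈ monicIrreduciblesOfDegree F d,
      (d : ℂ) * ψ P ^ (k / d) * monicSum ψ (n - k)) =
      ∑ d ∈ Finset.Icc 1 n, ∑ P ∈ monicIrreduciblesOfDegree F d, if d ∣ k then
        (d : ℂ) * ψ P ^ (k / d) * monicSum ψ (n - k) else 0 := by
    intro k hk
    rw [Finset.mem_Icc] at hk
    have : k.divisors = (Finset.Icc 1 n).filter (· ∣ k) := by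
      ext d
      simp only [Nat.mem_divisors, Finset.mem_filter, Finset.mem_Icc]
      constructor
      · rintro ⟨h, h0⟩
        exact ⟨⟨Nat.pos_of_dvd_of_pos h hk.1, (Nat.le_of_dvd hk.1 h).trans hk.2⟩, h⟩
      · rintro ⟨_, h⟩
        exact ⟨h, by omega⟩
    rw [this, Finset.sum_filter]
    refine Finset.sum_congr rfl fun d _ => ?_
    split_ifs <;> simp
  rw [Finset.sum_congr rfl h3, Finset.sum_comm]
  refine Finset.sum_congr rfl fun d hd => ?_
  conv_rhs => rw [Finset.sum_comm]
  refine Finset.sum_congr rfl fun P _ => ?_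
  rw [Finset.mem_Icc] at hd
  rw [← Finset.sum_filter, ← Finset.sum_filter]
  refine Finset.sum_bij (fun j _ => j * d) ?_ ?_ ?_ ?_
  · intro j hj
    simp only [Finset.mem_filter, Finset.mem_Icc] at hj ⊢
    exact ⟨⟨Nat.mul_pos hj.1.1 hd.1, hj.2⟩, dvd_mul_left _ _⟩
  · intro j _ j' _ h
    exact Nat.eq_of_mul_eq_mul_right hd.1 h
  · intro k hk
    simp only [Finset.mem_filter, Finset.mem_Icc] at hk
    obtain ⟨⟨hk1, hk2⟩, j, rfl⟩ := hk
    refine ⟨j, ?_, mul_comm _ _⟩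
    simp only [Finset.mem_filter, Finset.mem_Icc]
    refine ⟨⟨Nat.pos_of_mul_pos_left hk1, (Nat.le_mul_of_pos_left _ hd.1).trans hk2⟩, by linarith⟩
  · intro j _
    rw [Nat.mul_div_cancel _ hd.1]

/-- The product of the values of a multiplicative character at the evaluations of a polynomial
at the points of `A`. -/
noncomputable def evalChar (χ : MulChar F ℂ) (A : Finset F) : F[X] →* ℂ :=
  ∏ a ∈ A, χ.toMonoidHom.comp (evalRingHom a : F[X] →* F)

omit [Fintype F] in
theorem evalChar_apply (χ : MulChar F ℂ) (A : Finset F) (g : F[X]) :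
    evalChar χ A g = ∏ a ∈ A, χ (g.eval a) := by
  rw [evalChar, MonoidHom.finsetProd_apply]
  rfl

theorem monicSum_evalChar_eq_zero {χ : MulChar F ℂ} (hχ : χ ≠ 1) {A : Finset F}
    (hA : A.Nonempty) {n : ℕ} (hn : A.card ≤ n) : monicSum (evalChar χ A) n = 0 := by
  classical
  obtain ⟨a₀, ha₀⟩ := hA
  obtain ⟨u, hu⟩ := MulChar.ne_one_iff.mp hχ
  set ℓ : F[X] := ∏ a ∈ A.erase a₀, (X - C a) with hℓ
  have hℓdeg : ℓ.natDegree < n := by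
    rw [hℓ, natDegree_finsetProd_X_sub_C_eq_card, Finset.card_erase_of_mem ha₀]
    have := Finset.card_pos.mpr ⟨a₀, ha₀⟩
    omega
  have hℓ0 : ℓ.eval a₀ ≠ 0 := by
    rw [hℓ, eval_prod, Finset.prod_ne_zero_iff]
    intro a ha
    simpa [sub_eq_zero] using (Finset.ne_of_mem_erase ha).symm
  have hℓA : ∀ a ∈ A, a ≠ a₀ → ℓ.eval a = 0 := by
    intro a ha hne
    rw [hℓ, eval_prod]
    exact Finset.prod_eq_zero (Finset.mem_erase.mpr ⟨hne, ha⟩) (by simp)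
  let T : F[X] → F[X] := fun g => g + C ((u - 1) * g.eval a₀ / ℓ.eval a₀) * ℓ
  have hT0 : ∀ g, (T g).eval a₀ = u * g.eval a₀ := by
    intro g
    simp only [T, eval_add, eval_mul, eval_C]
    field_simp
    ring
  have hTmem : ∀ g ∈ monicsOfDegree F n, T g ∈ monicsOfDegree F n := by
    intro g hg
    rw [mem_monicsOfDegree] at hg ⊢
    have hlt : (C ((u - 1) * g.eval a₀ / ℓ.eval a₀) * ℓ).degree < g.degree := by
      rw [degree_eq_natDegree hg.1.ne_zero, hg.2]
      refine degree_le_natDegree.trans_lt ?_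
      exact_mod_cast (natDegree_C_mul_le _ _).trans_lt hℓdeg
    refine ⟨hg.1.add_of_left hlt, ?_⟩
    rw [← hg.2]
    exact natDegree_add_eq_left_of_degree_lt hlt
  have hTinj : Function.Injective T := by
    intro g g' h
    have h0 : g.eval a₀ = g'.eval a₀ := by
      have := congrArg (eval a₀) h
      rw [hT0, hT0] at this
      exact mul_left_cancel₀ u.ne_zero this
    simp only [T, h0] at h
    exact add_right_cancel h
  have hTψ : ∀ g, evalChar χ A (T g) = χ u * evalChar χ A g := by
    intro g
    rw [evalChar_apply, evalChar_apply, ← Finset.mul_prod_erase _ _ ha₀,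
      ← Finset.mul_prod_erase _ (fun a => χ (g.eval a)) ha₀, hT0, map_mul, mul_assoc]
    congr 2
    refine Finset.prod_congr rfl fun a ha => ?_
    simp [T, hℓA a (Finset.mem_of_mem_erase ha) (Finset.ne_of_mem_erase ha)]
  have key : monicSum (evalChar χ A) n = χ u * monicSum (evalChar χ A) n := by
    conv_lhs => rw [monicSum]
    rw [monicSum, Finset.mul_sum]
    symm
    refine Finset.sum_bij (fun g _ => T g) hTmem (fun g _ g' _ h => hTinj h) ?_
      (fun g _ => (hTψ g).symm)
    intro g hg
    obtain ⟨q, hq, hqg⟩ := Finset.surjOn_of_injOn_of_card_le T hTmem hTinj.injOn le_rfl hg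
    exact ⟨q, hq, hqg⟩
  have h2 : (χ u - 1) * monicSum (evalChar χ A) n = 0 := by linear_combination -key
  exact (mul_eq_zero.mp h2).resolve_left (sub_ne_zero.mpr hu)

end MonicSums

section Extension

open Polynomial IntermediateField

theorem Algebra.norm_algebraMap_sub_eq_eval_minpoly_pow {K L : Type*} [Field K] [Field L]
    [Algebra K L] [FiniteDimensional K L] (a : K) (x : L) :
    Algebra.norm K (algebraMap K L a - x) =
      (minpoly K x).eval a ^ (Module.finrank K L / (minpoly K x).natDegree) := by
  set y := x - algebraMap K L a with hy
  have hyint : IsIntegral K y := Algebra.IsIntegral.isIntegral y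
  have hmin : minpoly K y = (minpoly K x).comp (X + C a) := minpoly.sub_algebraMap x a
  have hdeg : (minpoly K y).natDegree = (minpoly K x).natDegree := by
    rw [hmin, natDegree_comp, natDegree_X_add_C, mul_one]
  have h1 : Algebra.norm K y =
      ((-1) ^ (minpoly K x).natDegree * (minpoly K x).eval a) ^
        (Module.finrank K L / (minpoly K x).natDegree) := by
    have hgen : (IntermediateField.adjoin.powerBasis hyint).gen = AdjoinSimple.gen K y :=
      IntermediateField.adjoin.powerBasis_gen _
    rw [Algebra.norm_eq_norm_adjoin K y, ← hgen,
      Algebra.PowerBasis.norm_gen_eq_coeff_zero_minpoly, hgen, minpoly_gen,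
      ← Module.finrank_mul_finrank K K⟮y⟯ L, IntermediateField.adjoin.finrank hyint, hdeg,
      Nat.mul_div_cancel_left _ (hdeg ▸ minpoly.natDegree_pos hyint),
      IntermediateField.adjoin.powerBasis_dim, hdeg, hmin, coeff_zero_eq_eval_zero, eval_comp]
    simp
  have h2 : algebraMap K L a - x = algebraMap K L (-1) * y := by
    rw [map_neg, map_one, hy]; ring
  have hdvd : (minpoly K x).natDegree ∣ Module.finrank K L := minpoly.degree_dvd
    (Algebra.IsIntegral.isIntegral x)
  rw [h2, map_mul, Algebra.norm_algebraMap, h1, mul_pow, ← pow_mul, Nat.mul_div_cancel' hdvd,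
    ← mul_assoc, ← mul_pow]
  simp

variable {F : Type*} [Field F] [Fintype F]

theorem card_filter_minpoly_eq {L : Type*} [Field L] [Fintype L] [Algebra F L] [DecidableEq F[X]]
    {P : F[X]} (hP : P.Monic) (hirr : Irreducible P)
    (hdvd : P.natDegree ∣ Module.finrank F L) :
    (Finset.univ.filter fun x : L => minpoly F x = P).card = P.natDegree := by
  classical
  have : (Finset.univ.filter fun x : L => minpoly F x = P) = (P.rootSet L).toFinset := by
    ext x
    simp only [Finset.mem_filter, Finset.mem_univ, true_and, Set.mem_toFinset,
      mem_rootSet_of_ne hP.ne_zero]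
    constructor
    · rintro rfl; exact minpoly.aeval F x
    · intro h
      exact (minpoly.eq_of_irreducible_of_monic hirr h hP).symm
  rw [this, Set.toFinset_card]
  refine card_rootSet_eq_natDegree (PerfectField.separable_of_irreducible hirr) ?_
  have h1 : P ∣ X ^ Nat.card F ^ Module.finrank F L - X :=
    hirr.natDegree_dvd_iff_dvd_X_pow_card_pow_sub_X.mp hdvd
  have h2 : (Nat.card F) ^ Module.finrank F L = Fintype.card L := by
    rw [Nat.card_eq_fintype_card, ← Module.card_eq_pow_finrank]
  rw [h2] at h1
  refine Splits.of_dvd (FiniteField.isSplittingField_sub L F).splits' ?_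
    (map_dvd (mapRingHom (algebraMap F L)) h1)
  exact map_ne_zero (FiniteField.X_pow_card_sub_X_ne_zero F Fintype.one_lt_card)

theorem primePowerSum_evalChar_eq_sum_norm (χ : MulChar F ℂ) (A : Finset F) (L : Type*) [Field L]
    [Fintype L] [Algebra F L] :
    primePowerSum (evalChar χ A) (Module.finrank F L) =
      ∑ x : L, ∏ a ∈ A, χ (Algebra.norm F (algebraMap F L a - x)) := by
  classical
  have : FiniteDimensional F L := Module.Finite.of_finite
  have hk : 0 < Module.finrank F L := Module.finrank_pos
  have h1 : ∀ x : L, ∏ a ∈ A, χ (Algebra.norm F (algebraMap F L a - x)) =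
      evalChar χ A (minpoly F x) ^ (Module.finrank F L / (minpoly F x).natDegree) := by
    intro x
    rw [evalChar_apply, ← Finset.prod_pow]
    refine Finset.prod_congr rfl fun a _ => ?_
    rw [Algebra.norm_algebraMap_sub_eq_eval_minpoly_pow, map_pow]
  have hmem : ∀ x ∈ (Finset.univ : Finset L), minpoly F x ∈
      (Module.finrank F L).divisors.biUnion (monicIrreduciblesOfDegree F) := by
    intro x _
    have hx : IsIntegral F x := Algebra.IsIntegral.isIntegral x
    rw [Finset.mem_biUnion]
    refine ⟨(minpoly F x).natDegree, ?_, ?_⟩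
    · exact Nat.mem_divisors.mpr ⟨minpoly.degree_dvd hx, hk.ne'⟩
    · exact mem_monicIrreduciblesOfDegree.mpr ⟨⟨minpoly.monic hx, rfl⟩, minpoly.irreducible hx⟩
  rw [Finset.sum_congr rfl fun x _ => h1 x, ← Finset.sum_fiberwise_of_maps_to hmem,
    Finset.sum_biUnion]
  · refine Finset.sum_congr rfl fun d hd => Finset.sum_congr rfl fun P hP => ?_
    rw [mem_monicIrreduciblesOfDegree] at hP
    obtain ⟨⟨hPm, rfl⟩, hPi⟩ := hP
    rw [Finset.sum_congr rfl (g := fun _ => evalChar χ A P ^ (Module.finrank F L / P.natDegree))]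
    · rw [Finset.sum_const, card_filter_minpoly_eq hPm hPi (Nat.dvd_of_mem_divisors hd),
        nsmul_eq_mul]
    · intro x hx
      rw [(Finset.mem_filter.mp hx).2]
  · intro d _ d' _ hdd
    rw [Function.onFun, Finset.disjoint_left]
    intro P hP hP'
    rw [mem_monicIrreduciblesOfDegree] at hP hP'
    exact hdd (hP.1.2.symm.trans hP'.1.2)

end Extension

section PowerSums

open Filter Topology

theorem norm_le_of_norm_sum_pow_le {ι : Type*} [Fintype ι] {z : ι → ℂ} {B R : ℝ} (hR : 0 < R)
    (h : ∀ k : ℕ, 1 ≤ k → ‖∑ i, z i ^ k‖ ≤ B * R ^ k) (i : ι) : ‖z i‖ ≤ R := by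
  have hu : ∀ j, ∃ u : Circle, z j = ‖z j‖ * (u : ℂ) := by
    intro j
    refine ⟨Circle.exp (z j).arg, ?_⟩
    rw [Circle.coe_exp, Complex.norm_mul_exp_arg_mul_I]
  choose u hu using hu
  have hfreq : ∃ᶠ k : ℕ in atTop, ∀ j, 1 / 2 < (((u ^ k) j : Circle) : ℂ).re := by
    have hopen : IsOpen {v : ι → Circle | ∀ j, 1 / 2 < ((v j : Circle) : ℂ).re} := by
      simp only [Set.ofPred_forall]
      refine isOpen_iInter_of_finite fun j => isOpen_lt continuous_const ?_
      fun_prop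
    exact (mapClusterPt_one_atTop_pow u).frequently (hopen.mem_nhds (by intro j; norm_num))
  by_contra! hlt
  have hev : ∀ᶠ k : ℕ in atTop, 2 * B < (‖z i‖ / R) ^ k :=
    (tendsto_pow_atTop_atTop_of_one_lt ((one_lt_div hR).mpr hlt)).eventually_gt_atTop _
  obtain ⟨k, hk, hkev, hk1⟩ := (hfreq.and_eventually (hev.and (eventually_ge_atTop 1))).exists
  have hre : (∑ j, z j ^ k).re = ∑ j, ‖z j‖ ^ k * (((u ^ k) j : Circle) : ℂ).re := by
    rw [Complex.re_sum]
    refine Finset.sum_congr rfl fun j _ => ?_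
    conv_lhs => rw [hu j]
    rw [mul_pow, ← Complex.ofReal_pow, Complex.re_ofReal_mul]
    simp
  have h1 : ‖z i‖ ^ k * (1 / 2) ≤ (∑ j, z j ^ k).re := by
    rw [hre]
    refine le_trans ?_ (Finset.single_le_sum
      (f := fun j => ‖z j‖ ^ k * (((u ^ k) j : Circle) : ℂ).re)
      (fun j _ => mul_nonneg (by positivity) (by linarith [hk j])) (Finset.mem_univ i))
    exact mul_le_mul_of_nonneg_left (hk i).le (by positivity)
  have h2 := (h1.trans (Complex.re_le_norm _)).trans (h k hk1)
  rw [div_pow, lt_div_iff₀ (by positivity)] at hkev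
  linarith

theorem Polynomial.exists_eq_prod_one_sub_mul_X {q : Polynomial ℂ} (hq : q.coeff 0 = 1) :
    ∃ ω : Multiset ℂ, ω.card = q.natDegree ∧
      q = (ω.map fun w => 1 - Polynomial.C w * Polynomial.X).prod := by
  have hq0 : q ≠ 0 := by rintro rfl; simp at hq
  have hspl := IsAlgClosed.splits q
  have hroots : ∀ r ∈ q.roots, r ≠ 0 := by
    rintro r hr rfl
    rw [Polynomial.mem_roots hq0, Polynomial.IsRoot, ← Polynomial.coeff_zero_eq_eval_zero, hq] at hr
    exact one_ne_zero hr
  refine ⟨q.roots.map fun r => r⁻¹, by rw [Multiset.card_map, hspl.natDegree_eq_card_roots], ?_⟩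
  have hfac : ∀ s : Multiset ℂ, (∀ r ∈ s, r ≠ 0) →
      (s.map fun r => Polynomial.X - Polynomial.C r).prod =
        Polynomial.C (s.map fun r => -r).prod *
          (s.map fun r => 1 - Polynomial.C r⁻¹ * Polynomial.X).prod := by
    intro s
    induction s using Multiset.induction with
    | empty => simp
    | cons r s ih =>
      intro hs
      have hr : r ≠ 0 := hs r (Multiset.mem_cons_self _ _)
      simp only [Multiset.map_cons, Multiset.prod_cons,
        ih fun x hx => hs x (Multiset.mem_cons_of_mem hx), Polynomial.C_mul]
      have : Polynomial.X - Polynomial.C r =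
          Polynomial.C (-r) * (1 - Polynomial.C r⁻¹ * Polynomial.X) := by
        rw [mul_sub, ← mul_assoc, ← Polynomial.C_mul, neg_mul, mul_inv_cancel₀ hr]
        simp
        ring
      rw [this]; ring
  have h1 := hspl.eq_prod_roots
  rw [hfac _ hroots, ← mul_assoc, ← Polynomial.C_mul] at h1
  set c := q.leadingCoeff * (q.roots.map fun r => -r).prod with hc
  have hc1 : c = 1 := by
    have h2 := congrArg (Polynomial.eval 0) h1
    rw [← Polynomial.coeff_zero_eq_eval_zero, hq, Polynomial.eval_mul, Polynomial.eval_C,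
      Polynomial.eval_multiset_prod] at h2
    simpa using h2.symm
  rw [hc1, Polynomial.C_1, one_mul] at h1
  rw [Multiset.map_map]
  exact h1

open PowerSeries in
theorem PowerSeries.X_mul_derivative_prod (ω : Multiset ℂ) :
    X * d⁄dX ℂ (ω.map fun w => 1 - C w * X).prod =
      (ω.map fun w => 1 - C w * X).prod *
        mk fun k => if k = 0 then 0 else -(ω.map (· ^ k)).sum := by
  induction ω using Multiset.induction with
  | empty =>
    have : (mk fun k => if k = 0 then 0 else -((0 : Multiset ℂ).map (· ^ k)).sum) = 0 := by
      ext k; simp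
    rw [this]; simp
  | cons w ω ih =>
    have h1 : (mk fun k => if k = 0 then 0 else -(((w ::ₘ ω).map (· ^ k)).sum)) =
        (mk fun k => if k = 0 then 0 else -w ^ k) +
          mk fun k => if k = 0 then 0 else -(ω.map (· ^ k)).sum := by
      ext k
      simp only [coeff_mk, map_add, Multiset.map_cons, Multiset.sum_cons]
      split_ifs <;> ring
    have h2 : (1 - C w * X) * (mk fun k => if k = 0 then 0 else -w ^ k) = -(C w * X) := by
      ext k
      rw [sub_mul, one_mul, mul_assoc, map_sub, coeff_C_mul, map_neg, coeff_C_mul]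
      rcases k with _ | _ | k
      · simp
      · simp [coeff_succ_X_mul]
      · simp only [coeff_succ_X_mul, coeff_mk, coeff_X]
        simp
        ring
    have h3 : d⁄dX ℂ (1 - C w * X : ℂ⟦X⟧) = -C w := by
      rw [map_sub, Derivation.leibniz]
      simp
    rw [h1, Multiset.map_cons, Multiset.prod_cons, Derivation.leibniz, h3, mul_add, smul_eq_mul,
      smul_eq_mul, mul_add]
    linear_combination (1 - C w * X) * ih - (ω.map fun w => 1 - C w * X).prod * h2

/-- The Newton identities: a sequence `s` determined by a polynomial `∑ a n * T ^ n` through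
logarithmic differentiation is given by power sums. -/
theorem exists_eq_neg_sum_pow {a s : ℕ → ℂ} {m : ℕ} (ha0 : a 0 = 1) (ham : ∀ n, m ≤ n → a n = 0)
    (h : ∀ n : ℕ, (n : ℂ) * a n = ∑ k ∈ Finset.Icc 1 n, s k * a (n - k)) :
    ∃ ω : Multiset ℂ, ω.card ≤ m - 1 ∧ ∀ k : ℕ, 1 ≤ k → s k = -(ω.map (· ^ k)).sum := by
  have hm : 0 < m := Nat.pos_of_ne_zero fun h0 => by
    have := ham 0 (by omega)
    rw [ha0] at this
    exact one_ne_zero this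
  set q : Polynomial ℂ := ∑ i ∈ Finset.range m, Polynomial.monomial i (a i) with hq
  have hcoeff : ∀ n, q.coeff n = a n := by
    intro n
    rw [hq, Polynomial.finsetSum_coeff]
    simp only [Polynomial.coeff_monomial]
    rw [Finset.sum_ite_eq' ]
    split_ifs with hn
    · rfl
    · exact (ham n (by simpa using hn)).symm
  obtain ⟨ω, hω, hqω⟩ := Polynomial.exists_eq_prod_one_sub_mul_X (q := q) (by rw [hcoeff, ha0])
  refine ⟨ω, ?_, ?_⟩
  · rw [hω, Polynomial.natDegree_le_iff_coeff_eq_zero]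
    intro n hn
    rw [hcoeff]
    exact ham n (by omega)
  have hA : (PowerSeries.mk a) = (ω.map fun w => 1 - PowerSeries.C w * PowerSeries.X).prod := by
    have h1 := congrArg (Polynomial.coeToPowerSeries.ringHom (R := ℂ)) hqω
    rw [map_multiset_prod, Multiset.map_map] at h1
    have h2 : PowerSeries.mk a = Polynomial.coeToPowerSeries.ringHom (R := ℂ) q := by
      ext n
      simp [hcoeff]
    rw [h2, h1]
    congr 1
    refine Multiset.map_congr rfl fun w _ => ?_
    simp
  have hS : PowerSeries.X * PowerSeries.derivative ℂ (PowerSeries.mk a) =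
      PowerSeries.mk a * PowerSeries.mk fun k => if k = 0 then 0 else s k := by
    ext n
    have h1 : PowerSeries.coeff n (PowerSeries.X * PowerSeries.derivative ℂ (PowerSeries.mk a)) =
        (n : ℂ) * a n := by
      rcases n with _ | n
      · simp
      · rw [PowerSeries.coeff_succ_X_mul, PowerSeries.coeff_derivative]
        simp [mul_comm]
    rw [h1, h n, mul_comm (PowerSeries.mk a), PowerSeries.coeff_mul,
      Finset.Nat.sum_antidiagonal_eq_sum_range_succ_mk]
    simp only [PowerSeries.coeff_mk]
    rw [Finset.range_eq_Ico, Finset.sum_eq_sum_Ico_succ_bot (by omega)]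
    simp only [if_true, zero_mul, zero_add]
    refine Finset.sum_congr (by ext; simp) fun k hk => ?_
    rw [if_neg (by simp at hk; omega)]
  have hA0 : PowerSeries.mk a ≠ 0 := by
    intro h0
    have := congrArg (PowerSeries.coeff 0) h0
    simp [ha0] at this
  have h3 := PowerSeries.X_mul_derivative_prod ω
  rw [← hA] at h3
  have h4 := mul_left_cancel₀ hA0 (hS.symm.trans h3)
  intro k hk
  have h5 := congrArg (PowerSeries.coeff k) h4
  simpa [show k ≠ 0 by omega] using h5

end PowerSums

section StepanovBound

open Polynomial

theorem card_filter_norm_prod_eq_le {p : ℕ} [Fact p.Prime] {A : Finset (ZMod p)} (hA : 0 ∈ A)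
    {L : Type*} [Field L] [Fintype L] [DecidableEq L] [Algebra (ZMod p) L] {μ : ℕ} (hP : 3 ≤ p ^ μ)
    (hL : Module.finrank (ZMod p) L = 2 * μ) {c : ZMod p} (hc : c ≠ 0) :
    (Finset.univ.filter fun x : L =>
      Algebra.norm (ZMod p) (∏ a ∈ A, (algebraMap (ZMod p) L a - x)) = c).card ≤
      p ^ μ * ((p ^ μ - 1) / (p - 1) + 3 * A.card + 4) := by
  have : CharP L p := charP_of_injective_algebraMap (algebraMap (ZMod p) L).injective p
  have hp := (Fact.out : p.Prime)
  have hcard : Fintype.card L = (p ^ μ) ^ 2 := by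
    rw [Module.card_eq_pow_finrank (K := ZMod p), hL, ZMod.card]; ring
  set h : L[X] := -∏ a ∈ A.erase 0, (C (algebraMap (ZMod p) L a) - X) with hh
  have hXh : X * h = ∏ a ∈ A, (C (algebraMap (ZMod p) L a) - X) := by
    rw [← Finset.mul_prod_erase _ _ hA, hh]
    simp
  have hdvd : p - 1 ∣ p ^ μ - 1 := by simpa using Nat.sub_dvd_pow_sub_pow p 1 μ
  have hG := Nat.mul_div_cancel' hdvd
  refine card_eval_pow_eq_le p μ _ (p - 1) _ _ rfl hP hG h ?_ ?_ (algebraMap (ZMod p) L c) ?_ _ ?_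
  · rw [hh, coeff_neg, neg_ne_zero, coeff_zero_eq_eval_zero, eval_prod, Finset.prod_ne_zero_iff]
    intro a ha
    simpa using Finset.ne_of_mem_erase ha
  · rw [hXh, natDegree_prod _ _ fun a _ => ?_]
    · rw [Finset.sum_congr rfl (g := fun _ => 1)]
      · simp
      · intro a _
        rw [natDegree_sub, natDegree_X_sub_C]
    · rw [← neg_ne_zero, neg_sub]
      exact X_sub_C_ne_zero _
  · simpa using hc
  · intro x hx
    rw [Finset.mem_filter] at hx
    refine ⟨by rw [← hcard]; exact FiniteField.pow_card x, ?_⟩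
    rw [hXh, eval_prod, ← hx.2, FiniteField.algebraMap_norm_eq_pow]
    simp only [eval_sub, eval_C, eval_X]
    congr 1
    rw [Nat.card_eq_fintype_card, Nat.card_eq_fintype_card, hcard, ZMod.card]
    symm
    apply Nat.div_eq_of_eq_mul_right (by have := hp.two_le; omega)
    rw [← mul_assoc, hG]
    obtain ⟨k, hk⟩ : ∃ k, p ^ μ = k + 1 := ⟨p ^ μ - 1, by omega⟩
    rw [hk]
    simp only [Nat.add_sub_cancel]
    have : (k + 1) ^ 2 = k * (k + 1 + 1) + 1 := by ring
    omega

theorem norm_sum_mulChar_norm_prod_le_of_zero_mem {p : ℕ} [Fact p.Prime] {χ : MulChar (ZMod p) ℂ}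
    (hχ : χ ≠ 1) {A : Finset (ZMod p)} (hA : 0 ∈ A) {L : Type*} [Field L] [Fintype L]
    [Algebra (ZMod p) L] {μ : ℕ} (hP : 3 ≤ p ^ μ) (hL : Module.finrank (ZMod p) L = 2 * μ) :
    ‖∑ x : L, ∏ a ∈ A, χ (Algebra.norm (ZMod p) (algebraMap (ZMod p) L a - x))‖ ≤
      (p * (3 * A.card + 4) + A.card) * (p : ℝ) ^ μ := by
  classical
  have hp := (Fact.out : p.Prime)
  set N : ZMod p → ℕ := fun c => (Finset.univ.filter fun x : L =>
      Algebra.norm (ZMod p) (∏ a ∈ A, (algebraMap (ZMod p) L a - x)) = c).card with hN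
  set B : ℕ := p ^ μ * ((p ^ μ - 1) / (p - 1) + 3 * A.card + 4) with hB
  have hNB : ∀ c ≠ 0, N c ≤ B := fun c hc => card_filter_norm_prod_eq_le hA hP hL hc
  have hN0 : N 0 ≤ A.card := by
    rw [hN]
    refine (Finset.card_le_card ?_).trans (Finset.card_image_le (f := algebraMap (ZMod p) L))
    intro x hx
    rw [Finset.mem_filter, Algebra.norm_eq_zero_iff, Finset.prod_eq_zero_iff] at hx
    obtain ⟨_, a, ha, hax⟩ := hx
    exact Finset.mem_image.mpr ⟨a, ha, sub_eq_zero.mp hax⟩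
  have hsumN : ∑ c, N c = (p ^ μ) ^ 2 := by
    rw [hN, Finset.sum_card_fiberwise_eq_card_filter]
    simp only [Finset.mem_univ, Finset.filter_true]
    rw [Finset.card_univ, Module.card_eq_pow_finrank (K := ZMod p), hL, ZMod.card]; ring
  have h1 : ∑ x : L, ∏ a ∈ A, χ (Algebra.norm (ZMod p) (algebraMap (ZMod p) L a - x)) =
      ∑ c ∈ Finset.univ.erase (0 : ZMod p), χ c * ((N c : ℂ) - B) := by
    have h2 : ∑ x : L, ∏ a ∈ A, χ (Algebra.norm (ZMod p) (algebraMap (ZMod p) L a - x)) =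
        ∑ c, χ c * (N c : ℂ) := by
      simp_rw [← map_prod]
      rw [← Finset.sum_fiberwise (s := Finset.univ) (g := fun x : L =>
        Algebra.norm (ZMod p) (∏ a ∈ A, (algebraMap (ZMod p) L a - x)))]
      refine Finset.sum_congr rfl fun c _ => ?_
      rw [Finset.sum_congr rfl (g := fun _ => χ c)]
      · rw [Finset.sum_const, nsmul_eq_mul, mul_comm]
      · intro x hx
        rw [(Finset.mem_filter.mp hx).2]
    have h3 : ∑ c, χ c * ((N c : ℂ) - B) = ∑ c, χ c * (N c : ℂ) := by
      simp_rw [mul_sub]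
      rw [Finset.sum_sub_distrib, ← Finset.sum_mul, MulChar.sum_eq_zero_of_ne_one hχ]
      simp
    rw [h2, ← h3, ← Finset.add_sum_erase _ (fun c => χ c * ((N c : ℂ) - B)) (Finset.mem_univ 0),
      MulChar.map_zero, zero_mul, zero_add]
  rw [h1]
  have h4 : ‖∑ c ∈ Finset.univ.erase (0 : ZMod p), χ c * ((N c : ℂ) - B)‖ ≤
      ∑ c ∈ Finset.univ.erase (0 : ZMod p), ((B : ℝ) - N c) := by
    refine norm_sum_le_of_le _ fun c hc => ?_
    have hle : (N c : ℝ) ≤ B := by exact_mod_cast hNB c (Finset.ne_of_mem_erase hc)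
    rw [norm_mul]
    have : ‖(N c : ℂ) - B‖ = (B : ℝ) - N c := by
      rw [norm_sub_rev, ← Complex.ofReal_natCast, ← Complex.ofReal_natCast, ← Complex.ofReal_sub,
        Complex.norm_real, Real.norm_of_nonneg (by linarith)]
    rw [this]
    exact mul_le_of_le_one_left (by linarith) (DirichletCharacter.norm_le_one χ c)
  refine h4.trans ?_
  rw [Finset.sum_sub_distrib, Finset.sum_const, nsmul_eq_mul,
    Finset.card_erase_of_mem (Finset.mem_univ _), Finset.card_univ, ZMod.card]
  have h5 : (N 0 : ℝ) + ∑ c ∈ Finset.univ.erase (0 : ZMod p), (N c : ℝ) = ((p : ℝ) ^ μ) ^ 2 := by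
    rw [Finset.add_sum_erase _ (fun c => (N c : ℝ)) (Finset.mem_univ 0)]
    exact_mod_cast hsumN
  have hdvd : p - 1 ∣ p ^ μ - 1 := by simpa using Nat.sub_dvd_pow_sub_pow p 1 μ
  have hG := Nat.mul_div_cancel' hdvd
  have h6 : ((p - 1 : ℕ) : ℝ) * B =
      p ^ μ * ((p ^ μ - 1) + ((p : ℝ) - 1) * (3 * A.card + 4)) := by
    have : (p - 1) * B = p ^ μ * ((p ^ μ - 1) + (p - 1) * (3 * A.card + 4)) := by
      rw [hB]
      conv_rhs => rw [← hG]
      ring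
    have h7 := congrArg (Nat.cast (R := ℝ)) this
    push_cast [Nat.cast_sub hp.one_le, Nat.cast_sub (show 1 ≤ p ^ μ by omega)] at h7 ⊢
    rw [h7]
  rw [h6]
  have hN0' : (N 0 : ℝ) ≤ A.card := by exact_mod_cast hN0
  have hP1 : (1 : ℝ) ≤ (p : ℝ) ^ μ := by exact_mod_cast (show 1 ≤ p ^ μ by omega)
  have hm : (0 : ℝ) ≤ A.card := Nat.cast_nonneg _
  nlinarith [mul_nonneg hm (sub_nonneg.mpr hP1)]

theorem norm_sum_mulChar_norm_prod_le {p : ℕ} [Fact p.Prime] {χ : MulChar (ZMod p) ℂ}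
    (hχ : χ ≠ 1) {A : Finset (ZMod p)} (hA : A.Nonempty) {L : Type*} [Field L] [Fintype L]
    [Algebra (ZMod p) L] {μ : ℕ} (hP : 3 ≤ p ^ μ) (hL : Module.finrank (ZMod p) L = 2 * μ) :
    ‖∑ x : L, ∏ a ∈ A, χ (Algebra.norm (ZMod p) (algebraMap (ZMod p) L a - x))‖ ≤
      (p * (3 * A.card + 4) + A.card) * (p : ℝ) ^ μ := by
  classical
  obtain ⟨b, hb⟩ := hA
  have h := norm_sum_mulChar_norm_prod_le_of_zero_mem hχ (A := A.image (· - b)) (L := L)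
    (Finset.mem_image.mpr ⟨b, hb, sub_self b⟩) hP hL
  rw [Finset.card_image_of_injective _ (sub_left_injective)] at h
  rw [← Equiv.sum_comp (Equiv.addRight (algebraMap (ZMod p) L b))]
  refine le_of_eq_of_le (congrArg _ (Finset.sum_congr rfl fun x _ => ?_)) h
  rw [Finset.prod_image (sub_left_injective.injOn)]
  refine Finset.prod_congr rfl fun a _ => ?_
  simp only [Equiv.coe_addRight, map_sub (algebraMap (ZMod p) L)]
  congr 2
  ring

theorem norm_sum_prod_mulChar_sub_le {p : ℕ} [Fact p.Prime] (hp2 : p ≠ 2) {χ : MulChar (ZMod p) ℂ}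
    (hχ : χ ≠ 1) {A : Finset (ZMod p)} (hA : A.Nonempty) :
    ‖∑ x : ZMod p, ∏ a ∈ A, χ (a - x)‖ ≤ (A.card - 1 : ℕ) * √p := by
  have hp := (Fact.out : p.Prime)
  have hp0 : (0 : ℝ) < p := by exact_mod_cast hp.pos
  have hp3 : 3 ≤ p := by
    have := hp.two_le
    omega
  obtain ⟨ω, hω, hs⟩ := exists_eq_neg_sum_pow (a := monicSum (evalChar χ A))
    (s := primePowerSum (evalChar χ A)) (m := A.card) (monicSum_zero _)
    (fun n hn => monicSum_evalChar_eq_zero hχ hA hn) (natCast_mul_monicSum _)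
  have hbound : ∀ k : ℕ, 1 ≤ k → ‖∑ i : ω.ToType, ((i.1 : ℂ) ^ 2) ^ k‖ ≤
      (p * (3 * A.card + 4) + A.card) * (p : ℝ) ^ k := by
    intro k hk
    have : Fintype (GaloisField p (2 * k)) := Fintype.ofFinite _
    have hfr : Module.finrank (ZMod p) (GaloisField p (2 * k)) = 2 * k :=
      GaloisField.finrank p (by omega)
    have h1 := primePowerSum_evalChar_eq_sum_norm χ A (GaloisField p (2 * k))
    rw [hfr, hs _ (by omega)] at h1
    have h2 : (ω.map (· ^ (2 * k))).sum = ∑ i : ω.ToType, ((i.1 : ℂ) ^ 2) ^ k := by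
      simp_rw [← pow_mul]
      conv_lhs => rw [← Multiset.map_univ (fun w : ℂ => w ^ (2 * k)) (m := ω)]
      rfl
    rw [← h2, ← norm_neg, h1]
    exact norm_sum_mulChar_norm_prod_le hχ hA (hp3.trans (Nat.le_self_pow (by omega) p)) hfr
  have hroot : ∀ w ∈ ω, ‖w‖ ≤ √p := by
    intro w hw
    have h1 := norm_le_of_norm_sum_pow_le hp0 hbound
      (⟨w, ⟨0, Multiset.count_pos.mpr hw⟩⟩ : ω.ToType)
    rw [norm_pow] at h1
    exact Real.le_sqrt_of_sq_le h1
  have h1 := primePowerSum_evalChar_eq_sum_norm χ A (ZMod p)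
  rw [Module.finrank_self, hs 1 le_rfl] at h1
  simp only [Algebra.norm_self, Algebra.algebraMap_self, RingHom.id_apply, MonoidHom.id_apply,
    pow_one, Multiset.map_id'] at h1
  rw [← h1, norm_neg]
  calc ‖ω.sum‖ ≤ (ω.map fun w => ‖w‖).sum := norm_multiset_sum_le _
    _ ≤ ω.card • √p := by
      rw [← Multiset.card_map (fun w : ℂ => ‖w‖) ω]
      refine Multiset.sum_le_card_nsmul _ _ fun x hx => ?_
      obtain ⟨w, hw, rfl⟩ := Multiset.mem_map.mp hx
      exact hroot w hw
    _ ≤ (A.card - 1 : ℕ) * √p := by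
      rw [nsmul_eq_mul]
      gcongr

end StepanovBound

section FactorialCharacterSum

open scoped Nat ComplexConjugate

variable {p : ℕ} [Fact p.Prime]

theorem ZMod.natCast_factorial_val_add {x : ZMod p} {k : ℕ} (h : x.val + k < p) :
    (((x + k).val ! : ℕ) : ZMod p) = (x.val ! : ℕ) * ∏ i ∈ Finset.range k, (x + (i + 1)) := by
  have hk : (k : ZMod p).val = k := ZMod.val_cast_of_lt (by omega)
  rw [ZMod.val_add_of_lt (by rwa [hk]), hk, ← Nat.factorial_mul_ascFactorial,
    Nat.ascFactorial_eq_prod_range]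
  push_cast
  rw [ZMod.natCast_zmod_val]
  congr 1
  exact Finset.prod_congr rfl fun i _ => by ring

theorem ZMod.prod_range_add_eq_zero_iff {x : ZMod p} {k : ℕ} (hk : k ≤ p) :
    ∏ i ∈ Finset.range k, (x + (i + 1 : ZMod p)) = 0 ↔ p ≤ x.val + k := by
  have hx := ZMod.val_lt x
  rw [Finset.prod_eq_zero_iff]
  have key : ∀ i < p, (x + (i + 1 : ZMod p) = 0 ↔ x.val + (i + 1) = p) := by
    intro i hi
    have h1 : x + (i + 1 : ZMod p) = ((x.val + (i + 1) : ℕ) : ZMod p) := by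
      push_cast
      rw [ZMod.natCast_zmod_val]
    rw [h1, ZMod.natCast_eq_zero_iff]
    constructor
    · rintro ⟨c, hc⟩
      have h2 : p * c < p * 2 := by omega
      have h3 : c < 2 := lt_of_mul_lt_mul_left h2 (Nat.zero_le _)
      interval_cases c <;> omega
    · intro h; rw [h]
  constructor
  · rintro ⟨i, hi, h⟩
    rw [Finset.mem_range] at hi
    rw [key i (by omega)] at h
    omega
  · intro h
    exact ⟨p - 1 - x.val, Finset.mem_range.mpr (by omega), (key _ (by omega)).mpr (by omega)⟩

theorem ZMod.card_filter_le_val_add_le (k : ℕ) :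
    (Finset.univ.filter fun x : ZMod p => p ≤ x.val + k).card ≤ k := by
  conv_rhs => rw [← Finset.card_range k]
  refine Finset.card_le_card_of_injOn (fun x => p - 1 - x.val) ?_ ?_
  · intro x hx
    have := ZMod.val_lt x
    simp only [Finset.coe_filter, Finset.mem_univ, true_and, Set.mem_ofPred_eq] at hx
    simp only [Finset.coe_range, Set.mem_Iio]
    omega
  · intro x _ y _ hxy
    have := ZMod.val_lt x
    have := ZMod.val_lt y
    simp only at hxy
    exact ZMod.val_injective p (by omega)

theorem norm_sum_factorial_sub_le (χ : MulChar (ZMod p) ℂ) {k : ℕ} (hk : k ≤ p) :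
    ‖∑ x : ZMod p, χ (x.val ! : ℕ) - ∑ x : ZMod p, χ (x.val ! : ℕ) *
      χ (∏ i ∈ Finset.range k, (x + (i + 1)))‖ ≤ k := by
  rw [← Equiv.sum_comp (Equiv.addRight (k : ZMod p)), ← Finset.sum_sub_distrib]
  have h : ∀ x : ZMod p, ‖χ ((Equiv.addRight (k : ZMod p) x).val ! : ℕ) - χ (x.val ! : ℕ) *
      χ (∏ i ∈ Finset.range k, (x + (i + 1)))‖ ≤ if p ≤ x.val + k then 1 else 0 := by
    intro x
    rw [Equiv.coe_addRight]
    split_ifs with hx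
    · rw [(ZMod.prod_range_add_eq_zero_iff hk).mpr hx, MulChar.map_zero, mul_zero, sub_zero]
      exact DirichletCharacter.norm_le_one χ _
    · rw [ZMod.natCast_factorial_val_add (by omega), map_mul, sub_self, norm_zero]
  refine (norm_sum_le_of_le _ fun x _ => h x).trans ?_
  rw [Finset.sum_boole]
  exact_mod_cast ZMod.card_filter_le_val_add_le k

theorem norm_sum_prod_range_mul_conj_le_of_lt (hp2 : p ≠ 2) {χ : MulChar (ZMod p) ℂ} (hχ : χ ≠ 1)
    {k l : ℕ} (hlk : l < k) (hk : k ≤ p) :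
    ‖∑ x : ZMod p, χ (∏ i ∈ Finset.range k, (x + (i + 1))) *
      conj (χ (∏ i ∈ Finset.range l, (x + (i + 1))))‖ ≤ l + k * √p := by
  set A : Finset (ZMod p) := (Finset.Ico l k).image fun i : ℕ => (i : ZMod p) + 1 with hA
  have hinj : Set.InjOn (fun i : ℕ => (i : ZMod p) + 1) (Finset.Ico l k) := by
    intro i hi j hj hij
    simp only [Finset.coe_Ico, Set.mem_Ico] at hi hj
    have h1 : (i : ZMod p) = j := add_right_cancel hij
    have h2 := congrArg ZMod.val h1
    rwa [ZMod.val_cast_of_lt (by omega), ZMod.val_cast_of_lt (by omega)] at h2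
  have hcard : A.card = k - l := by rw [hA, Finset.card_image_of_injOn hinj, Nat.card_Ico]
  have hweil := norm_sum_prod_mulChar_sub_le hp2 hχ (A := A)
    (Finset.card_pos.mp (by omega))
  have hW : ∑ x : ZMod p, ∏ a ∈ A, χ (a - x) =
      ∑ x : ZMod p, χ (∏ i ∈ Finset.Ico l k, (x + (i + 1))) := by
    rw [← Equiv.sum_comp (Equiv.neg (ZMod p))]
    refine Finset.sum_congr rfl fun x _ => ?_
    rw [hA, Finset.prod_image hinj, map_prod]
    refine Finset.prod_congr rfl fun i _ => ?_
    congr 1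
    simp only [Equiv.neg_apply]
    ring
  have hdiff : ‖∑ x : ZMod p, χ (∏ i ∈ Finset.range k, (x + (i + 1))) *
      conj (χ (∏ i ∈ Finset.range l, (x + (i + 1)))) -
      ∑ x : ZMod p, χ (∏ i ∈ Finset.Ico l k, (x + (i + 1)))‖ ≤ l := by
    rw [← Finset.sum_sub_distrib]
    have h : ∀ x : ZMod p, ‖χ (∏ i ∈ Finset.range k, (x + (i + 1))) *
        conj (χ (∏ i ∈ Finset.range l, (x + (i + 1)))) -
        χ (∏ i ∈ Finset.Ico l k, (x + (i + 1)))‖ ≤ if p ≤ x.val + l then 1 else 0 := by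
      intro x
      split_ifs with hx
      · rw [(ZMod.prod_range_add_eq_zero_iff (by omega)).mpr hx, MulChar.map_zero, map_zero,
          mul_zero, zero_sub, norm_neg]
        exact DirichletCharacter.norm_le_one χ _
      · have hne : ∏ i ∈ Finset.range l, (x + (i + 1 : ZMod p)) ≠ 0 := by
          rw [Ne, ZMod.prod_range_add_eq_zero_iff (by omega)]
          exact hx
        have hnorm : ‖χ (∏ i ∈ Finset.range l, (x + (i + 1 : ZMod p)))‖ = 1 :=
          DirichletCharacter.unit_norm_eq_one χ (Units.mk0 _ hne)
        rw [← Finset.prod_range_mul_prod_Ico _ hlk.le, map_mul, mul_right_comm, Complex.mul_conj,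
          Complex.normSq_eq_norm_sq, hnorm]
        simp
    refine (norm_sum_le_of_le _ fun x _ => h x).trans ?_
    rw [Finset.sum_boole]
    exact_mod_cast ZMod.card_filter_le_val_add_le l
  rw [hW] at hweil
  have h3 : ((A.card - 1 : ℕ) : ℝ) * √p ≤ k * √p := by
    gcongr
    omega
  have h4 := norm_sub_norm_le (∑ x : ZMod p, χ (∏ i ∈ Finset.range k, (x + (i + 1))) *
      conj (χ (∏ i ∈ Finset.range l, (x + (i + 1)))))
      (∑ x : ZMod p, χ (∏ i ∈ Finset.Ico l k, (x + (i + 1))))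
  linarith

theorem norm_sum_prod_range_mul_conj_le (hp2 : p ≠ 2) {χ : MulChar (ZMod p) ℂ} (hχ : χ ≠ 1)
    {K k l : ℕ} (hK : K ≤ p) (hk : k < K) (hl : l < K) :
    ‖∑ x : ZMod p, χ (∏ i ∈ Finset.range k, (x + (i + 1))) *
      conj (χ (∏ i ∈ Finset.range l, (x + (i + 1))))‖ ≤
      (if k = l then (p : ℝ) else 0) + 2 * K * √p := by
  have hp1 : 1 ≤ √(p : ℝ) := by
    rw [Real.one_le_sqrt]
    exact_mod_cast (Fact.out : p.Prime).one_le
  have hbig : ∀ {k l : ℕ}, k < K → l < K → (l : ℝ) + k * √p ≤ 2 * K * √p := by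
    intro k l hk hl
    have hk' : (k : ℝ) ≤ K := by exact_mod_cast hk.le
    have hl' : (l : ℝ) ≤ K := by exact_mod_cast hl.le
    nlinarith [(Nat.cast_nonneg K : (0 : ℝ) ≤ K)]
  rcases lt_trichotomy k l with h | h | h
  · rw [if_neg h.ne, zero_add, ← Complex.norm_conj, map_sum]
    refine le_of_eq_of_le (congrArg _ (Finset.sum_congr rfl fun x _ => ?_))
      ((norm_sum_prod_range_mul_conj_le_of_lt hp2 hχ h (hl.le.trans hK)).trans (hbig hl hk))
    rw [map_mul, Complex.conj_conj, mul_comm]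
  · subst h
    rw [if_pos rfl]
    have h1 : ‖∑ x : ZMod p, χ (∏ i ∈ Finset.range k, (x + (i + 1))) *
        conj (χ (∏ i ∈ Finset.range k, (x + (i + 1))))‖ ≤ ∑ _x : ZMod p, (1 : ℝ) := by
      refine norm_sum_le_of_le _ fun x _ => ?_
      rw [norm_mul, Complex.norm_conj]
      exact mul_le_one₀ (DirichletCharacter.norm_le_one χ _) (norm_nonneg _)
        (DirichletCharacter.norm_le_one χ _)
    rw [Finset.sum_const, Finset.card_univ, ZMod.card, nsmul_eq_mul, mul_one] at h1
    have : 0 ≤ 2 * (K : ℝ) * √p := by positivity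
    linarith
  · rw [if_neg h.ne', zero_add]
    exact (norm_sum_prod_range_mul_conj_le_of_lt hp2 hχ h (hk.le.trans hK)).trans (hbig hk hl)

theorem sum_norm_sum_prod_range_sq_le (hp2 : p ≠ 2) {χ : MulChar (ZMod p) ℂ} (hχ : χ ≠ 1)
    {K : ℕ} (hK : K ≤ p) :
    ∑ x : ZMod p, ‖∑ k ∈ Finset.range K, χ (∏ i ∈ Finset.range k, (x + (i + 1)))‖ ^ 2 ≤
      K * p + 2 * K ^ 3 * √p := by
  have h1 : ((∑ x : ZMod p, ‖∑ k ∈ Finset.range K,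
      χ (∏ i ∈ Finset.range k, (x + (i + 1)))‖ ^ 2 : ℝ) : ℂ) =
      ∑ k ∈ Finset.range K, ∑ l ∈ Finset.range K,
        ∑ x : ZMod p, χ (∏ i ∈ Finset.range k, (x + (i + 1))) *
          conj (χ (∏ i ∈ Finset.range l, (x + (i + 1)))) := by
    push_cast
    rw [Finset.sum_congr rfl fun k _ => Finset.sum_comm, Finset.sum_comm]
    refine Finset.sum_congr rfl fun x _ => ?_
    rw [← Complex.mul_conj', map_sum, Finset.sum_mul_sum]
  have h2 := congrArg norm h1
  rw [Complex.norm_real, Real.norm_of_nonneg (by positivity)] at h2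
  rw [h2]
  calc _ ≤ ∑ k ∈ Finset.range K, ∑ l ∈ Finset.range K,
        ((if k = l then (p : ℝ) else 0) + 2 * K * √p) := by
        refine norm_sum_le_of_le _ fun k hk => norm_sum_le_of_le _ fun l hl => ?_
        exact norm_sum_prod_range_mul_conj_le hp2 hχ hK (Finset.mem_range.mp hk)
          (Finset.mem_range.mp hl)
    _ = K * p + 2 * K ^ 3 * √p := by
        simp only [Finset.sum_add_distrib, Finset.sum_ite_eq, Finset.sum_const,
          Finset.card_range, nsmul_eq_mul]
        rw [Finset.sum_congr rfl (g := fun _ => (p : ℝ)) fun k hk => if_pos hk, Finset.sum_const,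
          Finset.card_range, nsmul_eq_mul]
        ring

theorem mul_norm_sum_factorial_le (hp2 : p ≠ 2) {χ : MulChar (ZMod p) ℂ} (hχ : χ ≠ 1)
    {K : ℕ} (hK : K ≤ p) :
    K * ‖∑ x : ZMod p, χ (x.val ! : ℕ)‖ ≤ K ^ 2 + √(p * (K * p + 2 * K ^ 3 * √p)) := by
  set S := ∑ x : ZMod p, χ (x.val ! : ℕ) with hS
  set V : ZMod p → ℂ := fun x =>
    ∑ k ∈ Finset.range K, χ (∏ i ∈ Finset.range k, (x + (i + 1))) with hV
  have h1 : ‖K * S - ∑ x : ZMod p, χ (x.val ! : ℕ) * V x‖ ≤ K ^ 2 := by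
    have h2 : K * S - ∑ x : ZMod p, χ (x.val ! : ℕ) * V x = ∑ k ∈ Finset.range K,
        (S - ∑ x : ZMod p, χ (x.val ! : ℕ) * χ (∏ i ∈ Finset.range k, (x + (i + 1)))) := by
      rw [Finset.sum_sub_distrib, Finset.sum_const, Finset.card_range, nsmul_eq_mul,
        Finset.sum_comm]
      simp only [hV, Finset.mul_sum]
    rw [h2]
    calc _ ≤ ∑ _k ∈ Finset.range K, (K : ℝ) := by
          refine norm_sum_le_of_le _ fun k hk => ?_
          rw [Finset.mem_range] at hk
          exact (norm_sum_factorial_sub_le χ (hk.le.trans hK)).trans (by exact_mod_cast hk.le)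
      _ = K ^ 2 := by
          rw [Finset.sum_const, Finset.card_range, nsmul_eq_mul]; ring
  have h3 : ‖∑ x : ZMod p, χ (x.val ! : ℕ) * V x‖ ≤ √(p * (K * p + 2 * K ^ 3 * √p)) := by
    have h4 : ‖∑ x : ZMod p, χ (x.val ! : ℕ) * V x‖ ≤ ∑ x : ZMod p, ‖V x‖ := by
      refine norm_sum_le_of_le _ fun x _ => ?_
      rw [norm_mul]
      exact mul_le_of_le_one_left (norm_nonneg _) (DirichletCharacter.norm_le_one χ _)
    refine h4.trans (Real.le_sqrt_of_sq_le ?_)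
    refine (sq_sum_le_card_mul_sum_sq (s := Finset.univ) (f := fun x => ‖V x‖)).trans ?_
    rw [Finset.card_univ, ZMod.card]
    gcongr
    exact sum_norm_sum_prod_range_sq_le hp2 hχ hK
  have h5 := norm_sub_norm_le (K * S) (∑ x : ZMod p, χ (x.val ! : ℕ) * V x)
  rw [norm_mul, Complex.norm_natCast] at h5
  linarith

theorem norm_sum_factorial_le (hp2 : p ≠ 2) {χ : MulChar (ZMod p) ℂ} (hχ : χ ≠ 1) {r : ℝ}
    (hr0 : 0 < r) (hr : r ^ 8 = p) : ‖∑ x : ZMod p, χ (x.val ! : ℕ)‖ ≤ 4 * r ^ 7 := by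
  have hp1 : (1 : ℝ) ≤ p := by exact_mod_cast (Fact.out : p.Prime).one_le
  have hr1 : 1 ≤ r := by
    by_contra! h
    have := pow_lt_one₀ hr0.le h (n := 8) (by norm_num)
    linarith
  have hsq : √(p : ℝ) = r ^ 4 := by
    rw [← hr, Real.sqrt_eq_iff_mul_self_eq_of_pos (by positivity)]
    ring
  set K := ⌊r ^ 2⌋₊ with hK
  have hKr : (K : ℝ) ≤ r ^ 2 := Nat.floor_le (by positivity)
  have hrK : r ^ 2 < K + 1 := Nat.lt_floor_add_one _
  have hK1 : (1 : ℝ) ≤ K := by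
    exact_mod_cast Nat.le_floor (by rw [Nat.cast_one]; exact one_le_pow₀ hr1)
  have hKp : K ≤ p := by
    have : (K : ℝ) ≤ p := by
      rw [← hr]
      exact hKr.trans (pow_le_pow_right₀ hr1 (by norm_num))
    exact_mod_cast this
  have h := mul_norm_sum_factorial_le hp2 hχ hKp
  rw [hsq, ← hr] at h
  have hK2 : (K : ℝ) ^ 2 ≤ r ^ 4 := by
    calc (K : ℝ) ^ 2 ≤ (r ^ 2) ^ 2 := by gcongr
      _ = r ^ 4 := by ring
  have h1 : √(r ^ 8 * (K * r ^ 8 + 2 * (K : ℝ) ^ 3 * r ^ 4)) ≤ 3 * (K * r ^ 7) := by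
    refine Real.sqrt_le_iff.mpr ⟨by positivity, ?_⟩
    have h2 : (K : ℝ) * r ^ 8 + 2 * (K : ℝ) ^ 3 * r ^ 4 ≤ 3 * K * r ^ 8 := by
      have : (K : ℝ) ^ 2 * (K * r ^ 4) ≤ r ^ 4 * (K * r ^ 4) := by gcongr
      nlinarith
    have h3 : r ^ 2 ≤ 2 * K := by linarith
    calc r ^ 8 * (K * r ^ 8 + 2 * (K : ℝ) ^ 3 * r ^ 4) ≤ r ^ 8 * (3 * K * r ^ 8) := by gcongr
      _ = 3 * K * r ^ 14 * r ^ 2 := by ring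
      _ ≤ 3 * K * r ^ 14 * (2 * K) := by gcongr
      _ ≤ (3 * (K * r ^ 7)) ^ 2 := by
        have : 0 ≤ (K : ℝ) ^ 2 * r ^ 14 := by positivity
        nlinarith
  have h4 : (K : ℝ) ^ 2 ≤ K * r ^ 7 := by
    have : (K : ℝ) ≤ r ^ 7 := hKr.trans (pow_le_pow_right₀ hr1 (by norm_num))
    nlinarith
  have h5 : K * ‖∑ x : ZMod p, χ (x.val ! : ℕ)‖ ≤ K * (4 * r ^ 7) := by linarith
  exact le_of_mul_le_mul_left h5 (by linarith)

end FactorialCharacterSum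

section FactorialEnergy

open scoped Nat ComplexConjugate

theorem Finset.card_filter_product_eq_sum_sq {α β : Type*} [DecidableEq β] (s : Finset α)
    {t : Finset β} {f : α → β} (hf : ∀ x ∈ s, f x ∈ t) :
    ((s ×ˢ s).filter fun q => f q.1 = f q.2).card = ∑ y ∈ t, (s.filter (f · = y)).card ^ 2 := by
  rw [card_eq_sum_card_fiberwise (f := fun q => f q.1) (t := t)]
  · refine sum_congr rfl fun y _ => ?_
    rw [sq, ← card_product]
    congr 1
    ext ⟨x, x'⟩
    simp only [mem_filter, mem_product]
    constructor
    · rintro ⟨⟨⟨h1, h2⟩, h3⟩, h4⟩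
      exact ⟨⟨h1, h4⟩, h2, h3 ▸ h4⟩
    · rintro ⟨⟨h1, h4⟩, h2, h5⟩
      exact ⟨⟨⟨h1, h2⟩, h4.trans h5.symm⟩, h4⟩
  · intro q hq
    simp only [coe_filter, mem_product, Set.mem_ofPred_eq] at hq
    exact hf _ hq.1.1

theorem Finset.card_filter_product_eq_le_mul {α β γ : Type*} [DecidableEq β] [DecidableEq γ]
    (s : Finset α) (f : α → β) {b : α → γ} {t : Finset γ} (hb : ∀ x ∈ s, b x ∈ t) :
    ((s ×ˢ s).filter fun q => f q.1 = f q.2).card ≤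
      t.card * ((s ×ˢ s).filter fun q => f q.1 = f q.2 ∧ b q.1 = b q.2).card := by
  have h1 := card_filter_product_eq_sum_sq s (f := f) (t := s.image f)
    fun x hx => mem_image_of_mem f hx
  have h2 := card_filter_product_eq_sum_sq s (f := fun x => (f x, b x)) (t := s.image f ×ˢ t)
    fun x hx => mem_product.mpr ⟨mem_image_of_mem f hx, hb x hx⟩
  simp only [Prod.mk.injEq] at h2
  rw [h1, h2, sum_product, mul_sum]
  refine sum_le_sum fun y _ => ?_
  have h3 : (s.filter (f · = y)).card = ∑ c ∈ t, (s.filter fun x => f x = y ∧ b x = c).card := by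
    rw [card_eq_sum_card_fiberwise (f := b) (t := t)]
    · simp only [filter_filter]
    · intro x hx
      exact hb x (mem_filter.mp hx).1
  simp only [h3, Prod.mk.injEq]
  exact sq_sum_le_card_mul_sum_sq (s := t)
    (f := fun c => (s.filter fun x => f x = y ∧ b x = c).card)

variable {p : ℕ} [Fact p.Prime]

theorem ZMod.natCast_factorial_ne_zero {n : ℕ} (hn : n < p) : ((n ! : ℕ) : ZMod p) ≠ 0 := by
  rw [Ne, ZMod.natCast_eq_zero_iff, (Fact.out : p.Prime).dvd_factorial]
  omega

open Polynomial in
theorem card_filter_factorial_add_eq_le {k : ℕ} (hk : 0 < k) :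
    ((Finset.range (p - k)).filter fun n =>
      (((n + k) ! : ℕ) : ZMod p) = (n ! : ℕ)).card ≤ k := by
  set P : (ZMod p)[X] := ∏ i ∈ Finset.range k, (X + C ((i : ZMod p) + 1)) with hP
  have hdeg : P.natDegree = k := by
    rw [hP, natDegree_prod_of_monic _ _ fun i _ => monic_X_add_C _,
      Finset.sum_congr rfl fun i _ => natDegree_X_add_C _]
    simp
  have hdeg1 : (P - 1).natDegree = k := by rw [← C_1, natDegree_sub_C, hdeg]
  have hne : P - 1 ≠ 0 := by
    intro h
    rw [h, natDegree_zero] at hdeg1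
    omega
  calc _ ≤ (P - 1).roots.toFinset.card := by
        refine Finset.card_le_card_of_injOn (fun n : ℕ => (n : ZMod p)) ?_ ?_
        · intro n hn
          rw [Finset.mem_coe, Finset.mem_filter, Finset.mem_range] at hn
          obtain ⟨hn, heq⟩ := hn
          have hval : (n : ZMod p).val = n := ZMod.val_cast_of_lt (by omega)
          have h1 := ZMod.natCast_factorial_val_add (x := (n : ZMod p)) (k := k)
            (by rw [hval]; omega)
          rw [← Nat.cast_add, ZMod.val_cast_of_lt (by omega), hval, heq] at h1
          have h2 := mul_left_cancel₀ (ZMod.natCast_factorial_ne_zero (p := p) (by omega))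
            ((mul_one _).trans h1)
          rw [Finset.mem_coe, Multiset.mem_toFinset, mem_roots hne, IsRoot, eval_sub, hP, eval_prod,
            eval_one, sub_eq_zero]
          simpa using h2.symm
        · intro n hn n' hn' h
          rw [Finset.mem_coe, Finset.mem_filter, Finset.mem_range] at hn hn'
          have h2 := congrArg ZMod.val h
          simpa only [ZMod.val_cast_of_lt (show n < p by omega),
            ZMod.val_cast_of_lt (show n' < p by omega)] using h2
    _ ≤ (P - 1).roots.card := Multiset.toFinset_card_le _
    _ ≤ k := hdeg1 ▸ card_roots' _

theorem card_filter_factorial_eq_near_le {K : ℕ} (hK : 0 < K) :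
    ((Finset.Icc 1 (p - 1) ×ˢ Finset.Icc 1 (p - 1)).filter fun q =>
      ((q.1 ! : ℕ) : ZMod p) = (q.2 ! : ℕ) ∧ q.1 / K = q.2 / K).card ≤ 2 * (p + K * K) := by
  set c : ℕ → Finset ℕ := fun k => (Finset.range (p - k)).filter fun n =>
      (((n + k) ! : ℕ) : ZMod p) = (n ! : ℕ) with hc
  have hcard : ∀ k ∈ Finset.range K, (c k).card ≤ (if k = 0 then p else 0) + K := by
    intro k hk
    rw [Finset.mem_range] at hk
    split_ifs with h
    · subst h
      exact ((Finset.card_filter_le _ _).trans (by simp)).trans (Nat.le_add_right p K)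
    · have := card_filter_factorial_add_eq_le (p := p) (k := k) (by omega)
      simp only [hc]
      omega
  have hsum : ∑ k ∈ Finset.range K, (c k).card ≤ p + K * K := by
    refine (Finset.sum_le_sum hcard).trans ?_
    rw [Finset.sum_add_distrib, Finset.sum_ite_eq', if_pos (Finset.mem_range.mpr hK),
      Finset.sum_const, Finset.card_range, smul_eq_mul]
  have hsub : ((Finset.Icc 1 (p - 1) ×ˢ Finset.Icc 1 (p - 1)).filter fun q =>
      ((q.1 ! : ℕ) : ZMod p) = (q.2 ! : ℕ) ∧ q.1 / K = q.2 / K) ⊆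
      ((Finset.range K).sigma c).image (fun s => (s.2 + s.1, s.2)) ∪
        ((Finset.range K).sigma c).image (fun s => (s.2, s.2 + s.1)) := by
    have hlt : ∀ m n : ℕ, m / K = n / K → n < m + K := by
      intro m n h
      have h1 := Nat.div_add_mod m K
      have h2 := Nat.div_add_mod n K
      have h3 := Nat.mod_lt n hK
      rw [h] at h1
      omega
    rintro ⟨m, n⟩ hq
    simp only [Finset.mem_filter, Finset.mem_product, Finset.mem_Icc] at hq
    obtain ⟨⟨hm, hn⟩, heq, hdiv⟩ := hq
    have := hlt m n hdiv
    have := hlt n m hdiv.symm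
    simp only [Finset.mem_union, Finset.mem_image, Finset.mem_sigma, Finset.mem_range, hc,
      Finset.mem_filter, Sigma.exists, Prod.mk.injEq]
    rcases le_total n m with h | h
    · exact Or.inl ⟨m - n, n, ⟨by omega, by omega, by rw [Nat.add_sub_cancel' h, heq]⟩,
        by omega, rfl⟩
    · exact Or.inr ⟨n - m, m, ⟨by omega, by omega, by rw [Nat.add_sub_cancel' h, heq]⟩,
        rfl, by omega⟩
  refine (Finset.card_le_card hsub).trans ((Finset.card_union_le _ _).trans ?_)
  rw [two_mul]
  refine add_le_add ?_ ?_ <;>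
  exact Finset.card_image_le.trans ((Finset.card_sigma _ _).trans_le hsum)

theorem card_filter_factorial_eq_le :
    (((Finset.Icc 1 (p - 1) ×ˢ Finset.Icc 1 (p - 1)).filter fun q =>
      ((q.1 ! : ℕ) : ZMod p) = (q.2 ! : ℕ)).card : ℝ) ≤ 20 * √p ^ 3 := by
  set K := Nat.sqrt p + 1 with hK
  have hp := (Fact.out : p.Prime)
  have h1 := Finset.card_filter_product_eq_le_mul (Finset.Icc 1 (p - 1))
    (fun n => ((n ! : ℕ) : ZMod p)) (b := (· / K)) (t := Finset.range K) (by
      intro n hn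
      rw [Finset.mem_Icc] at hn
      rw [Finset.mem_range, Nat.div_lt_iff_lt_mul (by omega)]
      have := Nat.lt_succ_sqrt p
      have hp1 := hp.pos
      rw [Nat.succ_eq_add_one, ← hK] at this
      omega)
  have h2 := h1.trans (Nat.mul_le_mul_left _
    (card_filter_factorial_eq_near_le (p := p) (K := K) (by omega)))
  rw [Finset.card_range] at h2
  have h3 : (((Finset.Icc 1 (p - 1) ×ˢ Finset.Icc 1 (p - 1)).filter fun q =>
      ((q.1 ! : ℕ) : ZMod p) = (q.2 ! : ℕ)).card : ℝ) ≤ K * (2 * (p + K * K)) := by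
    exact_mod_cast h2
  refine h3.trans ?_
  have hs1 : 1 ≤ √(p : ℝ) := Real.one_le_sqrt.mpr (by exact_mod_cast hp.one_le)
  have hsq : √(p : ℝ) ^ 2 = p := Real.sq_sqrt (Nat.cast_nonneg p)
  have hKs : (K : ℝ) ≤ 2 * √p := by
    have : (Nat.sqrt p : ℝ) ≤ √p := Real.nat_sqrt_le_real_sqrt
    rw [hK]
    push_cast
    linarith
  calc (K : ℝ) * (2 * (p + K * K)) ≤ (2 * √p) * (2 * (p + (2 * √p) * (2 * √p))) := by gcongr
    _ = 20 * √p ^ 3 := by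
      nth_rewrite 2 [← hsq]
      ring

theorem sum_norm_sum_factorial_sq_le :
    ∑ χ : MulChar (ZMod p) ℂ, ‖∑ n ∈ Finset.Icc 1 (p - 1), χ (n ! : ℕ)‖ ^ 2 ≤
      (p - 1) * (20 * √p ^ 3) := by
  have hp := (Fact.out : p.Prime)
  have h1 : ((∑ χ : MulChar (ZMod p) ℂ, ‖∑ n ∈ Finset.Icc 1 (p - 1), χ (n ! : ℕ)‖ ^ 2 : ℝ) : ℂ) =
      ((p - 1 : ℕ) : ℂ) * ((Finset.Icc 1 (p - 1) ×ˢ Finset.Icc 1 (p - 1)).filter fun q =>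
      ((q.1 ! : ℕ) : ZMod p) = (q.2 ! : ℕ)).card := by
    push_cast
    rw [Finset.sum_congr rfl (g := fun χ : MulChar (ZMod p) ℂ =>
      ∑ q ∈ Finset.Icc 1 (p - 1) ×ˢ Finset.Icc 1 (p - 1),
        χ ((q.1 ! : ℕ) : ZMod p)⁻¹ * χ (q.2 ! : ℕ))]
    · rw [Finset.sum_comm, Finset.card_filter]
      push_cast
      rw [Finset.mul_sum]
      refine Finset.sum_congr rfl fun q hq => ?_
      rw [Finset.mem_product, Finset.mem_Icc, Finset.mem_Icc] at hq
      have := DirichletCharacter.sum_char_inv_mul_char_eq ℂ (n := p)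
        (a := ((q.1 ! : ℕ) : ZMod p)) (IsUnit.mk0 _ (ZMod.natCast_factorial_ne_zero (by omega)))
        ((q.2 ! : ℕ) : ZMod p)
      rw [this, Nat.totient_prime hp, mul_ite, mul_one, mul_zero]
    · intro χ _
      rw [← Complex.conj_mul', map_sum, Finset.sum_mul_sum, Finset.sum_product]
      refine Finset.sum_congr rfl fun m _ => Finset.sum_congr rfl fun n _ => ?_
      rw [← MulChar.inv_apply', ← MulChar.star_apply']
      rfl
  have h2 : ∑ χ : MulChar (ZMod p) ℂ, ‖∑ n ∈ Finset.Icc 1 (p - 1), χ (n ! : ℕ)‖ ^ 2 =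
      ((p - 1 : ℕ) : ℝ) * ((Finset.Icc 1 (p - 1) ×ˢ Finset.Icc 1 (p - 1)).filter fun q =>
      ((q.1 ! : ℕ) : ZMod p) = (q.2 ! : ℕ)).card := by
    exact_mod_cast h1
  rw [h2, Nat.cast_sub hp.one_le, Nat.cast_one]
  have : (1 : ℝ) ≤ p := by exact_mod_cast hp.one_le
  exact mul_le_mul_of_nonneg_left card_filter_factorial_eq_le (by linarith)

theorem norm_sum_Icc_factorial_le (hp2 : p ≠ 2) {χ : MulChar (ZMod p) ℂ} (hχ : χ ≠ 1) {r : ℝ}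
    (hr1 : 1 ≤ r) (hr : r ^ 8 = p) : ‖∑ n ∈ Finset.Icc 1 (p - 1), χ (n ! : ℕ)‖ ≤ 5 * r ^ 7 := by
  have hp := (Fact.out : p.Prime)
  have h1 : ∑ x : ZMod p, χ (x.val ! : ℕ) = 1 + ∑ n ∈ Finset.Icc 1 (p - 1), χ (n ! : ℕ) := by
    have h2 : ∑ x : ZMod p, χ (x.val ! : ℕ) = ∑ n ∈ Finset.range p, χ (n ! : ℕ) := by
      refine Finset.sum_bij (fun x _ => x.val) ?_ ?_ ?_ ?_
      · intro x _
        exact Finset.mem_range.mpr (ZMod.val_lt x)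
      · intro x _ y _ h
        exact ZMod.val_injective p h
      · intro n hn
        exact ⟨n, Finset.mem_univ _, ZMod.val_cast_of_lt (Finset.mem_range.mp hn)⟩
      · intro x _
        rfl
    have h3 : Finset.Ico 1 p = Finset.Icc 1 (p - 1) := by
      ext n
      have := hp.pos
      simp only [Finset.mem_Ico, Finset.mem_Icc]
      omega
    rw [h2, Finset.range_eq_Ico, Finset.sum_eq_sum_Ico_succ_bot hp.pos, zero_add, h3]
    simp
  have h2 := norm_sum_factorial_le hp2 hχ (by linarith) hr
  have h3 : ∑ n ∈ Finset.Icc 1 (p - 1), χ (n ! : ℕ) = ∑ x : ZMod p, χ (x.val ! : ℕ) - 1 := by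
    rw [h1]; ring
  rw [h3]
  have h4 := norm_sub_le (∑ x : ZMod p, χ (x.val ! : ℕ)) 1
  rw [norm_one] at h4
  have h5 : 1 ≤ r ^ 7 := one_le_pow₀ hr1
  linarith

theorem sub_one_mul_card_filter_prod_factorial_eq {a : ZMod p} (ha : a ≠ 0) (k : ℕ) :
    ((p : ℂ) - 1) * ((Fintype.piFinset fun _ : Fin k => Finset.Icc 1 (p - 1)).filter
        fun n => (∏ i, ((n i) ! : ZMod p)) = a).card =
      ∑ χ : MulChar (ZMod p) ℂ, χ a⁻¹ * (∑ n ∈ Finset.Icc 1 (p - 1), χ (n ! : ℕ)) ^ k := by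
  have hp := (Fact.out : p.Prime)
  have h1 : ∀ χ : MulChar (ZMod p) ℂ, χ a⁻¹ * (∑ n ∈ Finset.Icc 1 (p - 1), χ (n ! : ℕ)) ^ k =
      ∑ n ∈ Fintype.piFinset fun _ : Fin k => Finset.Icc 1 (p - 1),
        χ a⁻¹ * χ (∏ i, ((n i) ! : ZMod p)) := by
    intro χ
    have := Finset.prod_univ_sum (fun _ : Fin k => Finset.Icc 1 (p - 1))
      (fun _ n => χ (n ! : ℕ))
    rw [Finset.prod_const, Finset.card_univ, Fintype.card_fin] at this
    rw [this, Finset.mul_sum]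
    simp only [map_prod]
  rw [Finset.sum_congr rfl fun χ _ => h1 χ, Finset.sum_comm, Finset.card_filter]
  push_cast
  rw [Finset.mul_sum]
  refine Finset.sum_congr rfl fun n _ => ?_
  have := DirichletCharacter.sum_char_inv_mul_char_eq ℂ (n := p) (IsUnit.mk0 a ha)
    (∏ i, ((n i) ! : ZMod p))
  rw [this, Nat.totient_prime hp, mul_ite, mul_one, mul_zero, Nat.cast_sub hp.one_le, Nat.cast_one]
  simp only [eq_comm]

theorem abs_card_filter_prod_factorial_sub_le (hp2 : p ≠ 2) {a : ZMod p} (ha : a ≠ 0) {r : ℝ}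
    (hr1 : 1 ≤ r) (hr : r ^ 8 = p) :
    |(((Fintype.piFinset fun _ : Fin 7 => Finset.Icc 1 (p - 1)).filter
        fun n => (∏ i, ((n i) ! : ZMod p)) = a).card : ℝ) - ((p : ℝ) - 1) ^ 6| ≤
      62500 * r ^ 47 := by
  classical
  have hp := (Fact.out : p.Prime)
  set S : MulChar (ZMod p) ℂ → ℂ := fun χ => ∑ n ∈ Finset.Icc 1 (p - 1), χ (n ! : ℕ) with hS
  set N := ((Fintype.piFinset fun _ : Fin 7 => Finset.Icc 1 (p - 1)).filter
        fun n => (∏ i, ((n i) ! : ZMod p)) = a).card with hN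
  have hp1 : (0 : ℝ) < p - 1 := by
    have : (2 : ℝ) ≤ p := by exact_mod_cast hp.two_le
    linarith
  have hS1 : S 1 = p - 1 := by
    rw [hS]
    simp only
    rw [Finset.sum_congr rfl (g := fun _ => (1 : ℂ))]
    · rw [Finset.sum_const, Nat.card_Icc, nsmul_eq_mul, mul_one, Nat.add_sub_cancel,
        Nat.cast_sub hp.one_le, Nat.cast_one]
    · intro n hn
      rw [Finset.mem_Icc] at hn
      have := hp.pos
      exact MulChar.one_apply (IsUnit.mk0 _ (ZMod.natCast_factorial_ne_zero (by omega)))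
  have h1 := sub_one_mul_card_filter_prod_factorial_eq ha 7
  rw [← hN, ← Finset.add_sum_erase _ _ (Finset.mem_univ 1)] at h1
  change _ = (1 : MulChar (ZMod p) ℂ) a⁻¹ * S 1 ^ 7 +
    ∑ χ ∈ Finset.univ.erase (1 : MulChar (ZMod p) ℂ), χ a⁻¹ * S χ ^ 7 at h1
  rw [MulChar.one_apply (IsUnit.mk0 _ (inv_ne_zero ha)), one_mul, hS1] at h1
  have h2 : ‖∑ χ ∈ Finset.univ.erase (1 : MulChar (ZMod p) ℂ), χ a⁻¹ * S χ ^ 7‖ ≤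
      (5 * r ^ 7) ^ 5 * ∑ χ : MulChar (ZMod p) ℂ, ‖S χ‖ ^ 2 := by
    refine (norm_sum_le _ _).trans ?_
    rw [Finset.mul_sum]
    refine (Finset.sum_le_sum fun χ hχ => ?_).trans (Finset.sum_le_sum_of_subset_of_nonneg
      (Finset.erase_subset 1 Finset.univ) fun χ _ _ => by positivity)
    have hb : ‖S χ‖ ≤ 5 * r ^ 7 := norm_sum_Icc_factorial_le hp2 (Finset.ne_of_mem_erase hχ) hr1 hr
    rw [norm_mul, norm_pow]
    calc ‖χ a⁻¹‖ * ‖S χ‖ ^ 7 ≤ 1 * ‖S χ‖ ^ 7 := by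
          gcongr
          exact DirichletCharacter.norm_le_one χ _
      _ = ‖S χ‖ ^ 5 * ‖S χ‖ ^ 2 := by ring
      _ ≤ (5 * r ^ 7) ^ 5 * ‖S χ‖ ^ 2 := by gcongr
  have h3 : ((p : ℝ) - 1) * |(N : ℝ) - ((p : ℝ) - 1) ^ 6| =
      ‖∑ χ ∈ Finset.univ.erase (1 : MulChar (ZMod p) ℂ), χ a⁻¹ * S χ ^ 7‖ := by
    have h5 : ∑ χ ∈ Finset.univ.erase (1 : MulChar (ZMod p) ℂ), χ a⁻¹ * S χ ^ 7 =
        (p - 1) * (N : ℂ) - (p - 1) ^ 7 := by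
      rw [h1]; ring
    have : (p - 1) * (N : ℂ) - (p - 1) ^ 7 =
        ((((p : ℝ) - 1) * ((N : ℝ) - ((p : ℝ) - 1) ^ 6) : ℝ) : ℂ) := by
      push_cast
      ring
    rw [h5, this, Complex.norm_real, Real.norm_eq_abs, abs_mul, abs_of_pos hp1]
  have hsq : √(p : ℝ) = r ^ 4 := by
    rw [← hr, Real.sqrt_eq_iff_mul_self_eq_of_pos (by positivity)]
    ring
  have h4 := sum_norm_sum_factorial_sq_le (p := p)
  rw [hsq] at h4
  refine le_of_mul_le_mul_left ?_ hp1
  calc ((p : ℝ) - 1) * |(N : ℝ) - ((p : ℝ) - 1) ^ 6|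
      ≤ (5 * r ^ 7) ^ 5 * ∑ χ : MulChar (ZMod p) ℂ, ‖S χ‖ ^ 2 := h3.trans_le h2
    _ ≤ (5 * r ^ 7) ^ 5 * (((p : ℝ) - 1) * (20 * (r ^ 4) ^ 3)) := by gcongr
    _ = ((p : ℝ) - 1) * (62500 * r ^ 47) := by ring

end FactorialEnergy

/-- Asymptotic for `F_7(a, 0, p-1)`: uniformly for `a ≢ 0 (mod p)`, the number
of `7`-tuples `(n_1, …, n_7)` with `1 ≤ n_i ≤ p - 1` and
`n_1! ⋯ n_7! ≡ a (mod p)` equals `p^6 (1 + O(p^{-1/8} (log p)^{5/4}))`. -/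
theorem count_seven_factorial_product_representations :
    ∃ C : ℝ, 0 < C ∧ ∀ p : ℕ, p.Prime → Odd p →
      ∀ a : ZMod p, a ≠ 0 →
        |((((Fintype.piFinset fun _ : Fin 7 => Finset.Icc 1 (p - 1))).filter
            fun n => (∏ i, ((n i).factorial : ZMod p)) = a).card : ℝ) - (p : ℝ) ^ 6| ≤
          C * (p : ℝ) ^ ((6 : ℝ) - 1 / 8) * (Real.log p) ^ ((5 : ℝ) / 4) := by
  refine ⟨62506, by norm_num, fun p hp hodd a ha => ?_⟩
  have : Fact p.Prime := ⟨hp⟩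
  have hp2 : p ≠ 2 := by
    rintro rfl
    exact absurd hodd (by decide)
  have hp3 : (3 : ℝ) ≤ p := by
    have := hp.two_le
    exact_mod_cast (show 3 ≤ p by omega)
  set r : ℝ := (p : ℝ) ^ ((1 : ℝ) / 8) with hr
  have hr1 : 1 ≤ r := Real.one_le_rpow (by linarith) (by norm_num)
  have hr8 : r ^ 8 = p := by
    rw [hr, ← Real.rpow_natCast, ← Real.rpow_mul (by linarith)]
    norm_num
  have hr47 : (p : ℝ) ^ ((6 : ℝ) - 1 / 8) = r ^ 47 := by
    rw [hr, ← Real.rpow_natCast, ← Real.rpow_mul (by linarith)]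
    norm_num
  have hlog : 1 ≤ Real.log p ^ ((5 : ℝ) / 4) := by
    refine Real.one_le_rpow ?_ (by norm_num)
    rw [Real.le_log_iff_exp_le (by linarith)]
    linarith [Real.exp_one_lt_three]
  have h1 := abs_card_filter_prod_factorial_sub_le hp2 ha hr1 hr8
  have h2 : |((p : ℝ) - 1) ^ 6 - (p : ℝ) ^ 6| ≤ 6 * r ^ 47 := by
    have h3 : ((p : ℝ) - 1) ^ 6 ≤ (p : ℝ) ^ 6 := by
      gcongr <;> linarith
    have h4 : (p : ℝ) ^ 6 - ((p : ℝ) - 1) ^ 6 ≤ 6 * (p : ℝ) ^ 5 := by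
      have h5 := one_add_mul_le_pow (a := -(1 / (p : ℝ))) (by
        have : 1 / (p : ℝ) ≤ 1 := by rw [div_le_one (by linarith)]; linarith
        linarith) 6
      have h6 : (p : ℝ) ^ 6 * (1 + -(1 / (p : ℝ))) ^ 6 = ((p : ℝ) - 1) ^ 6 := by
        rw [← mul_pow]
        congr 1
        field_simp
        ring
      have h7 : (p : ℝ) ^ 6 * (1 + (6 : ℕ) * -(1 / (p : ℝ))) = (p : ℝ) ^ 6 - 6 * (p : ℝ) ^ 5 := by
        field_simp
        push_cast
        ring
      have h8 := mul_le_mul_of_nonneg_left h5 (show 0 ≤ (p : ℝ) ^ 6 by positivity)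
      rw [h6, h7] at h8
      linarith
    have h5 : (p : ℝ) ^ 5 ≤ r ^ 47 := by
      rw [← hr8, ← pow_mul]
      exact pow_le_pow_right₀ hr1 (by norm_num)
    rw [abs_sub_comm, abs_of_nonneg (by linarith)]
    linarith
  rw [hr47]
  refine (abs_sub_le _ (((p : ℝ) - 1) ^ 6) _).trans ((add_le_add h1 h2).trans ?_)
  have h3 : 0 ≤ 62506 * r ^ 47 := by positivity
  nlinarith
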